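/- (Hypergraph removal lemma, functional form.) Let d ≥ 1. For every ε > 0 there exists δ > 0 such that the following holds. Let (X_1,μ_1),…,(X_{d+1},μ_{d+1}) be finite probability spaces and for each 1 ≤ i ≤ d+1 let f^{(i)} : ∏_{j ≠ i} X_j → [0,1]. If |∫_{X_1}⋯∫_{X_{d+1}} ∏_{i=1}^{d+1} f^{(i)}(x_{[d+1]∖{i}}) dμ_1(x_1)⋯dμ_{d+1}(x_{d+1})| ≤ δ, then there exist sets E_i ⊆ ∏_{j ≠ i} X_j (1 ≤ i ≤ d+1) such that ∏_{i=1}^{d+1} 1_{E_i}(x_{[d+1]∖{i}}) = 0 for every x ∈ X_1 × ⋯ × X_{d+1}, and ∫ f^{(i)} · 1_{E_i^c} d(⊗_{j ≠ i} μ_j) ≤ ε for every 1 ≤ i ≤ d+1. -/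

import Mathlib

open MeasureTheory Set Filter Topology

section CondProb

variable {Ω : Type*} {n : MeasurableSpace Ω} {m0 : MeasurableSpace Ω}

/-- A version of the conditional probability of `B` given `n` with values in `[0, 1]`. -/
noncomputable def condProb (μ : Measure Ω) (n : MeasurableSpace Ω) (B : Set Ω) : Ω → ℝ :=
  fun ω => max 0 (min 1 ((μ[B.indicator (1 : Ω → ℝ) | n]) ω))

theorem condProb_nonneg (μ : Measure Ω) (n : MeasurableSpace Ω) (B : Set Ω) (ω : Ω) :
    0 ≤ condProb μ n B ω := le_max_left _ _

theorem condProb_le_one (μ : Measure Ω) (n : MeasurableSpace Ω) (B : Set Ω) (ω : Ω) :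
    condProb μ n B ω ≤ 1 := max_le zero_le_one (min_le_left _ _)

theorem measurable_condProb (μ : Measure Ω) (n : MeasurableSpace Ω) (B : Set Ω) :
    Measurable[n] (condProb μ n B) := by
  have h : Measurable[n] (μ[B.indicator (1 : Ω → ℝ) | n]) :=
    (stronglyMeasurable_condExp (m := n)).measurable
  exact measurable_const.max (measurable_const.min h)

theorem integrable_of_unit {μ : Measure Ω} [IsFiniteMeasure μ] {F : Ω → ℝ} (hF : Measurable F)
    (h0 : ∀ ω, 0 ≤ F ω) (h1 : ∀ ω, F ω ≤ 1) : Integrable F μ :=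
  Integrable.of_bound hF.aestronglyMeasurable 1
    (ae_of_all _ fun ω => by rw [Real.norm_eq_abs, abs_of_nonneg (h0 ω)]; exact h1 ω)

theorem setIntegral_indicator_one {μ : Measure Ω} {B S : Set Ω} (hB : MeasurableSet B) :
    ∫ ω in S, B.indicator (1 : Ω → ℝ) ω ∂μ = μ.real (S ∩ B) := by
  rw [integral_indicator_one hB, measureReal_restrict_apply hB, inter_comm]

variable {μ : Measure Ω} [IsFiniteMeasure μ] {B S : Set Ω} {F : Ω → ℝ}

theorem condProb_ae_eq (hn : n ≤ m0) (hB : MeasurableSet B) :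
    condProb μ n B =ᵐ[μ] μ[B.indicator (1 : Ω → ℝ) | n] := by
  have hi : Integrable (B.indicator (1 : Ω → ℝ)) μ := (integrable_const (1 : ℝ)).indicator hB
  have h0 : 0 ≤ᵐ[μ] μ[B.indicator (1 : Ω → ℝ) | n] :=
    condExp_nonneg (ae_of_all _ fun ω => indicator_nonneg (fun _ _ => zero_le_one) ω)
  have h1 : μ[B.indicator (1 : Ω → ℝ) | n] ≤ᵐ[μ] μ[(fun _ => (1 : ℝ)) | n] :=
    condExp_mono hi (integrable_const _)
      (ae_of_all _ fun ω => indicator_le_self' (fun _ _ => zero_le_one) ω)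
  rw [condExp_const hn] at h1
  filter_upwards [h0, h1] with ω a b
  simp only [condProb]
  rw [min_eq_right b]
  exact max_eq_right a

/-- `p` integrates against `[0, 1]`-valued `n`-measurable functions as the indicator of `B` as
soon as it does so on `n`-measurable sets. -/
theorem integral_mul_eq_setIntegral_of_forall {p : Ω → ℝ} (hn : n ≤ m0) (hB : MeasurableSet B)
    (hp : Integrable p μ)
    (h : ∀ S, MeasurableSet[n] S → ∫ ω in S, p ω ∂μ = μ.real (S ∩ B))
    (hF : Measurable[n] F) (h0 : ∀ ω, 0 ≤ F ω) (h1 : ∀ ω, F ω ≤ 1) :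
    ∫ ω, F ω * p ω ∂μ = ∫ ω, F ω * B.indicator 1 ω ∂μ := by
  have hi : Integrable (B.indicator (1 : Ω → ℝ)) μ := (integrable_const (1 : ℝ)).indicator hB
  have hce : μ[p | n] =ᵐ[μ] μ[B.indicator (1 : Ω → ℝ) | n] := by
    refine ae_eq_condExp_of_forall_setIntegral_eq hn hi
      (fun s _ _ => integrable_condExp.integrableOn) (fun S hS _ => ?_)
      stronglyMeasurable_condExp.aestronglyMeasurable
    rw [setIntegral_condExp hn hp hS, h S hS, setIntegral_indicator_one hB]
  have hb : ∀ᵐ ω ∂μ, ‖F ω‖ ≤ 1 :=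
    ae_of_all _ fun ω => by rw [Real.norm_eq_abs, abs_of_nonneg (h0 ω)]; exact h1 ω
  have e1 := condExp_stronglyMeasurable_mul_of_bound hn hF.stronglyMeasurable hp 1 hb
  have e2 := condExp_stronglyMeasurable_mul_of_bound hn hF.stronglyMeasurable hi 1 hb
  calc ∫ ω, F ω * p ω ∂μ = ∫ ω, (μ[F * p | n]) ω ∂μ := (integral_condExp hn).symm
    _ = ∫ ω, (μ[F * B.indicator 1 | n]) ω ∂μ := by
        refine integral_congr_ae ?_
        filter_upwards [e1, e2, hce] with ω a b c
        rw [a, b, Pi.mul_apply, Pi.mul_apply, c]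
    _ = ∫ ω, F ω * B.indicator 1 ω ∂μ := integral_condExp hn

theorem setIntegral_condProb (hn : n ≤ m0) (hB : MeasurableSet B) (hS : MeasurableSet[n] S) :
    ∫ ω in S, condProb μ n B ω ∂μ = μ.real (S ∩ B) := by
  have hi : Integrable (B.indicator (1 : Ω → ℝ)) μ := (integrable_const (1 : ℝ)).indicator hB
  rw [setIntegral_congr_ae (g := μ[B.indicator (1 : Ω → ℝ) | n]) (hn _ hS)
    ((condProb_ae_eq hn hB).mono fun ω h _ => h), setIntegral_condExp hn hi hS,
    setIntegral_indicator_one hB]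

end CondProb

section DensityPoints

variable {Ω : Type*} {m : MeasurableSpace Ω} {m0 : MeasurableSpace Ω} {μ : Measure Ω}
  [IsFiniteMeasure μ]

/-- If `A` is close to a set which on every cell of the finite partition `e` is
`m`-measurable, then `A` has small intersection with the union of the cells on which its relative
density given `m` is not close to one. -/
theorem measureReal_low_density_le (hm : m ≤ m0) {σ : Type*} [Finite σ]
    {e : Ω → σ} (he : ∀ s, MeasurableSet (e ⁻¹' {s})) {A : Set Ω} (hA : MeasurableSet A)
    {D : σ → Set Ω} (hD : ∀ s, MeasurableSet[m] (D s)) {p q : σ → Ω → ℝ}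
    (hpm : ∀ s, Measurable[m] (p s)) (hqm : ∀ s, Measurable[m] (q s))
    (hpi : ∀ s, Integrable (p s) μ) (hqi : ∀ s, Integrable (q s) μ)
    (hp : ∀ s S, MeasurableSet[m] S → ∫ ω in S, p s ω ∂μ = μ.real (S ∩ e ⁻¹' {s}))
    (hq : ∀ s S, MeasurableSet[m] S → ∫ ω in S, q s ω ∂μ = μ.real (S ∩ (Aᶜ ∩ e ⁻¹' {s})))
    {θ : ℝ} (hθ : 0 < θ) :
    μ.real (A ∩ {ω | θ * p (e ω) ω < q (e ω) ω}) ≤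
      (1 + θ⁻¹) * μ.real (symmDiff A {ω | ω ∈ D (e ω)}) := by
  have := Fintype.ofFinite σ
  have hGm : ∀ s, MeasurableSet[m] {ω | θ * p s ω < q s ω} := fun s =>
    measurableSet_lt ((hpm s).const_mul θ) (hqm s)
  have hDe : {ω | ω ∈ D (e ω)} = ⋃ s, e ⁻¹' {s} ∩ D s := by ext ω; simp
  have hDm : MeasurableSet {ω | ω ∈ D (e ω)} := by
    rw [hDe]; exact MeasurableSet.iUnion fun s => (he s).inter (hm _ (hD s))
  have hsub : A ∩ {ω | θ * p (e ω) ω < q (e ω) ω} ⊆ (A \ {ω | ω ∈ D (e ω)}) ∪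
      ⋃ s, (D s ∩ {ω | θ * p s ω < q s ω}) ∩ e ⁻¹' {s} := by
    rintro ω ⟨hωA, hω⟩
    by_cases h : ω ∈ D (e ω)
    · exact Or.inr (mem_iUnion.2 ⟨e ω, ⟨h, hω⟩, rfl⟩)
    · exact Or.inl ⟨hωA, h⟩
  have hcell : ∀ s, μ.real ((D s ∩ {ω | θ * p s ω < q s ω}) ∩ e ⁻¹' {s}) ≤
      θ⁻¹ * μ.real (e ⁻¹' {s} ∩ (D s ∩ Aᶜ)) := by
    intro s
    have hS := (hD s).inter (hGm s)
    have h1 : ∫ ω in D s ∩ {ω | θ * p s ω < q s ω}, θ * p s ω ∂μ ≤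
        ∫ ω in D s ∩ {ω | θ * p s ω < q s ω}, q s ω ∂μ :=
      setIntegral_mono_on ((hpi s).const_mul θ).integrableOn (hqi s).integrableOn (hm _ hS)
        fun ω hω => le_of_lt hω.2
    rw [integral_const_mul, hp s _ hS, hq s _ hS] at h1
    rw [← div_eq_inv_mul, le_div_iff₀' hθ]
    refine h1.trans (measureReal_mono ?_)
    rintro ω ⟨⟨h1, -⟩, h2, h3⟩
    exact ⟨h3, h1, h2⟩
  have hsum : ∑ s, μ.real (e ⁻¹' {s} ∩ (D s ∩ Aᶜ)) = μ.real ({ω | ω ∈ D (e ω)} \ A) := by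
    rw [← measureReal_iUnion_fintype]
    · congr 1; ext ω; simp
    · intro s t hst
      refine Set.disjoint_left.2 ?_
      rintro ω ⟨h1, -⟩ ⟨h2, -⟩
      exact hst (h1.symm.trans h2)
    · exact fun s => (he s).inter ((hm _ (hD s)).inter hA.compl)
  have hA' : μ.real (A \ {ω | ω ∈ D (e ω)}) ≤ μ.real (symmDiff A {ω | ω ∈ D (e ω)}) :=
    measureReal_mono subset_union_left
  have hA'' : μ.real ({ω | ω ∈ D (e ω)} \ A) ≤ μ.real (symmDiff A {ω | ω ∈ D (e ω)}) :=
    measureReal_mono subset_union_right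
  calc _ ≤ μ.real (A \ {ω | ω ∈ D (e ω)}) +
        ∑ s, μ.real ((D s ∩ {ω | θ * p s ω < q s ω}) ∩ e ⁻¹' {s}) :=
        (measureReal_mono hsub).trans ((measureReal_union_le _ _).trans
          (by gcongr; exact measureReal_iUnion_fintype_le _))
    _ ≤ μ.real (symmDiff A {ω | ω ∈ D (e ω)}) +
        ∑ s, θ⁻¹ * μ.real (e ⁻¹' {s} ∩ (D s ∩ Aᶜ)) := by
        gcongr with s
        exact hcell s
    _ ≤ _ := by
        rw [← Finset.mul_sum, hsum, add_mul, one_mul]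
        gcongr

end DensityPoints

section CondIndepSystem

variable {Ω V : Type*} [DecidableEq V]

/-- A monotone family of σ-algebras indexed by finite sets of coordinates, such that an event on
the coordinates `I` is, given its restrictions to the sets `J ∩ I`, independent of the
σ-algebras indexed by the sets `J`. -/
structure CondIndepSystem {m0 : MeasurableSpace Ω} (μ : Measure Ω)
    (m : Finset V → MeasurableSpace Ω) : Prop where
  le : ∀ I, m I ≤ m0
  mono : Monotone m
  setIntegral_eq : ∀ (I : Finset V) (F : Set (Finset V)) (B S : Set Ω), MeasurableSet[m I] B →
    MeasurableSet[⨆ J ∈ F, m J] S →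
      ∫ ω in S, condProb μ (⨆ J ∈ F, m (J ∩ I)) B ω ∂μ = μ.real (S ∩ B)

/-- The σ-algebra generated by the subsets of `J` with fewer than `r` elements. -/
def lowerAlgebra (m : Finset V → MeasurableSpace Ω) (J : Finset V) (r : ℕ) : MeasurableSpace Ω :=
  ⨆ I ∈ {I : Finset V | I ⊆ J ∧ I.card < r}, m I

theorem le_lowerAlgebra (m : Finset V → MeasurableSpace Ω) {I J : Finset V} {r : ℕ} (hIJ : I ⊆ J)
    (hI : I.card < r) : m I ≤ lowerAlgebra m J r :=
  le_iSup₂ (f := fun (I : Finset V) (_ : I ∈ {I : Finset V | I ⊆ J ∧ I.card < r}) => m I) I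
    ⟨hIJ, hI⟩

theorem lowerAlgebra_le_biSup (m : Finset V → MeasurableSpace Ω) {J : Finset V} {r : ℕ}
    {F : Set (Finset V)} (hF : ∀ I ⊆ J, I.card < r → I ∈ F) :
    lowerAlgebra m J r ≤ ⨆ I ∈ F, m I :=
  biSup_mono fun I hI => hF I hI.1 hI.2

theorem le_biSup_of_mem (m : Finset V → MeasurableSpace Ω) {I : Finset V}
    {F : Set (Finset V)} (hI : I ∈ F) : m I ≤ ⨆ I ∈ F, m I :=
  le_iSup₂ (f := fun (I : Finset V) (_ : I ∈ F) => m I) I hI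

theorem measurable_indicator_one {m : MeasurableSpace Ω} {B : Set Ω} (hB : MeasurableSet B) :
    Measurable (B.indicator (1 : Ω → ℝ)) := measurable_one.indicator hB

theorem indicator_one_nonneg (B : Set Ω) (ω : Ω) : 0 ≤ B.indicator (1 : Ω → ℝ) ω :=
  indicator_nonneg (fun _ _ => zero_le_one) ω

theorem indicator_one_le_one (B : Set Ω) (ω : Ω) : B.indicator (1 : Ω → ℝ) ω ≤ 1 :=
  indicator_le_self' (fun _ _ => zero_le_one) ω

theorem prod_indicator_one {ι : Type*} (T : Finset ι) (B : ι → Set Ω) (ω : Ω) :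
    ∏ i ∈ T, (B i).indicator (1 : Ω → ℝ) ω = (⋂ i ∈ T, B i).indicator 1 ω := by
  classical
  by_cases h : ∀ i ∈ T, ω ∈ B i
  · rw [indicator_of_mem (by simpa using h), Finset.prod_eq_one]
    · rfl
    · intro i hi; rw [indicator_of_mem (h i hi)]; rfl
  · rw [indicator_of_notMem (by simpa using h)]
    push Not at h
    obtain ⟨i, hi, hω⟩ := h
    exact Finset.prod_eq_zero hi (indicator_of_notMem hω _)

variable {m0 : MeasurableSpace Ω} {μ : Measure Ω} [IsProbabilityMeasure μ]
  {m : Finset V → MeasurableSpace Ω}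

namespace CondIndepSystem

theorem biSup_le (h : CondIndepSystem μ m) (F : Set (Finset V)) : ⨆ J ∈ F, m J ≤ m0 :=
  iSup₂_le fun I _ => h.le I

theorem lowerAlgebra_le_zero (h : CondIndepSystem μ m) (J : Finset V) (r : ℕ) :
    lowerAlgebra m J r ≤ m0 := h.biSup_le _

theorem lowerAlgebra_le (h : CondIndepSystem μ m) (J : Finset V) (r : ℕ) :
    lowerAlgebra m J r ≤ m J := iSup₂_le fun _ hI => h.mono hI.1

theorem biSup_inter_eq (h : CondIndepSystem μ m) {I : Finset V} {r : ℕ} {F : Set (Finset V)}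
    (hF : ∀ J ∈ F, (J ∩ I).card < r) (hF' : ∀ J ⊆ I, J.card < r → J ∈ F) :
    ⨆ J ∈ F, m (J ∩ I) = lowerAlgebra m I r := by
  refine le_antisymm (iSup₂_le fun J hJ => le_lowerAlgebra m Finset.inter_subset_right (hF J hJ))
    (iSup₂_le fun J hJ => ?_)
  have h1 : J ∩ I = J := Finset.inter_eq_left.2 hJ.1
  have h2 := le_iSup₂ (f := fun (J : Finset V) (_ : J ∈ F) => m (J ∩ I)) J (hF' J hJ.1 hJ.2)
  simp only [h1] at h2
  exact h2

theorem integral_mul_condProb (h : CondIndepSystem μ m) {I : Finset V} {r : ℕ}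
    {F : Set (Finset V)} (hF : ∀ J ∈ F, (J ∩ I).card < r) (hF' : ∀ J ⊆ I, J.card < r → J ∈ F)
    {B : Set Ω} (hB : MeasurableSet[m I] B) {f : Ω → ℝ} (hf : Measurable[⨆ J ∈ F, m J] f)
    (h0 : ∀ ω, 0 ≤ f ω) (h1 : ∀ ω, f ω ≤ 1) :
    ∫ ω, f ω * B.indicator 1 ω ∂μ = ∫ ω, f ω * condProb μ (lowerAlgebra m I r) B ω ∂μ := by
  refine (integral_mul_eq_setIntegral_of_forall (h.biSup_le F) (h.le I _ hB)
    (integrable_of_unit ((measurable_condProb _ _ _).mono (h.lowerAlgebra_le_zero _ _) le_rfl)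
      (condProb_nonneg _ _ _) (condProb_le_one _ _ _)) (fun S hS => ?_) hf h0 h1).symm
  rw [← h.biSup_inter_eq hF hF']
  exact h.setIntegral_eq I F B S hB hS

/-- Events on distinct coordinate sets of size `r` are independent given everything of
smaller size. -/
theorem integral_mul_prod_indicator (h : CondIndepSystem μ m) {r : ℕ} (T : Finset (Finset V))
    (hT : ∀ I ∈ T, I.card = r) {B : Finset V → Set Ω} (hB : ∀ I ∈ T, MeasurableSet[m I] (B I))
    {f : Ω → ℝ} (hf : Measurable[⨆ J ∈ {J : Finset V | J.card < r + 1 ∧ J ∉ T}, m J] f)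
    (h0 : ∀ ω, 0 ≤ f ω) (h1 : ∀ ω, f ω ≤ 1) :
    ∫ ω, f ω * ∏ I ∈ T, (B I).indicator 1 ω ∂μ =
      ∫ ω, f ω * ∏ I ∈ T, condProb μ (lowerAlgebra m I r) (B I) ω ∂μ := by
  induction T using Finset.induction_on generalizing f with
  | empty => simp
  | insert I₀ T hI₀ ih =>
    have hI₀r : I₀.card = r := hT I₀ (Finset.mem_insert_self _ _)
    have hBm : ∀ I ∈ T, MeasurableSet[m I] (B I) := fun I hI => hB I (Finset.mem_insert_of_mem hI)
    have e1 : ∫ ω, (f ω * ∏ I ∈ T, (B I).indicator 1 ω) * (B I₀).indicator 1 ω ∂μ =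
        ∫ ω, (f ω * ∏ I ∈ T, (B I).indicator 1 ω) *
          condProb μ (lowerAlgebra m I₀ r) (B I₀) ω ∂μ := by
      refine h.integral_mul_condProb (F := {J : Finset V | J.card < r + 1 ∧ J ≠ I₀})
        ?_ ?_ (hB I₀ (Finset.mem_insert_self _ _)) ?_ ?_ ?_
      · rintro J ⟨hJ, hJ'⟩
        by_contra hc
        have hle := Finset.card_le_card (Finset.inter_subset_right (s₁ := J) (s₂ := I₀))
        have e1 : J ∩ I₀ = I₀ := Finset.eq_of_subset_of_card_le Finset.inter_subset_right (by omega)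
        have e2 : J ∩ I₀ = J := Finset.eq_of_subset_of_card_le Finset.inter_subset_left (by omega)
        exact hJ' (e2.symm.trans e1)
      · intro J hJ hJr
        exact ⟨by omega, by rintro rfl; omega⟩
      · refine Measurable.mul (hf.mono (biSup_mono ?_) le_rfl) (Finset.measurable_prod _ ?_)
        · rintro J ⟨hJ, hJ'⟩
          exact ⟨hJ, by rintro rfl; exact hJ' (Finset.mem_insert_self _ _)⟩
        · intro I hI
          refine measurable_indicator_one (le_biSup_of_mem m ?_ _ (hBm I hI))
          exact ⟨by rw [hT I (Finset.mem_insert_of_mem hI)]; omega,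
            by rintro rfl; exact hI₀ hI⟩
      · exact fun ω => mul_nonneg (h0 ω)
          (Finset.prod_nonneg fun I _ => indicator_one_nonneg _ _)
      · exact fun ω => mul_le_one₀ (h1 ω)
          (Finset.prod_nonneg fun I _ => indicator_one_nonneg _ _)
          (Finset.prod_le_one (fun I _ => indicator_one_nonneg _ _)
            fun I _ => indicator_one_le_one _ _)
    have e2 := ih (fun I hI => hT I (Finset.mem_insert_of_mem hI)) hBm
      (f := fun ω => f ω * condProb μ (lowerAlgebra m I₀ r) (B I₀) ω) ?_ ?_ ?_
    · simp only [Finset.prod_insert hI₀]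
      calc _ = ∫ ω, (f ω * ∏ I ∈ T, (B I).indicator 1 ω) * (B I₀).indicator 1 ω ∂μ := by
            congr 1; ext ω; ring
        _ = ∫ ω, (f ω * condProb μ (lowerAlgebra m I₀ r) (B I₀) ω) *
            ∏ I ∈ T, (B I).indicator 1 ω ∂μ := by
            rw [e1]; congr 1; ext ω; ring
        _ = _ := by rw [e2]; congr 1; ext ω; ring
    · refine Measurable.mul (hf.mono (biSup_mono ?_) le_rfl)
        ((measurable_condProb _ _ _).mono (lowerAlgebra_le_biSup m ?_) le_rfl)
      · rintro J ⟨hJ, hJ'⟩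
        exact ⟨hJ, fun hc => hJ' (Finset.mem_insert_of_mem hc)⟩
      · intro J _ hJr
        exact ⟨by omega, fun hc => by have := hT J (Finset.mem_insert_of_mem hc); omega⟩
    · exact fun ω => mul_nonneg (h0 ω) (condProb_nonneg _ _ _ _)
    · exact fun ω => mul_le_one₀ (h1 ω) (condProb_nonneg _ _ _ _) (condProb_le_one _ _ _ _)

/-- Sets measurable with respect to coordinate sets of size at most `r` are approximated by finite
colourings of the `r`-faces and sets measurable with respect to smaller coordinate sets. -/
theorem exists_approx (h : CondIndepSystem μ m) (J : Finset V) (r : ℕ) {A : Set Ω}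
    (hA : MeasurableSet[lowerAlgebra m J (r + 1)] A) {η : ℝ} (hη : 0 < η) :
    ∃ (κ : Type) (_ : Finite κ) (c : Finset V → Ω → κ) (D : (J.powersetCard r → κ) → Set Ω),
      (∀ I b, MeasurableSet[m I] (c I ⁻¹' {b})) ∧ (∀ s, MeasurableSet[lowerAlgebra m J r] (D s)) ∧
      μ.real (symmDiff A {ω | ω ∈ D fun I => c I ω}) < η := by
  let 𝒜 : Set (Set Ω) := {S | ∃ (κ : Type) (_ : Finite κ) (c : Finset V → Ω → κ)
    (D : (J.powersetCard r → κ) → Set Ω),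
      (∀ I b, MeasurableSet[m I] (c I ⁻¹' {b})) ∧ (∀ s, MeasurableSet[lowerAlgebra m J r] (D s)) ∧
      S = {ω | ω ∈ D fun I => c I ω}}
  have h𝒜 : IsSetAlgebra 𝒜 := by
    refine ⟨?_, ?_, ?_⟩
    · exact ⟨Unit, inferInstance, fun _ _ => (), fun _ => ∅, fun I b => by simp,
        fun _ => @MeasurableSet.empty _ (_), by simp⟩
    · rintro S ⟨κ, hκ, c, D, hc, hD, rfl⟩
      exact ⟨κ, hκ, c, fun s => (D s)ᶜ, hc, fun s => (hD s).compl, rfl⟩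
    · rintro S S' ⟨κ, hκ, c, D, hc, hD, rfl⟩ ⟨κ', hκ', c', D', hc', hD', rfl⟩
      refine ⟨κ × κ', inferInstance, fun I ω => (c I ω, c' I ω),
        fun s => D (fun I => (s I).1) ∪ D' (fun I => (s I).2), ?_, ?_, rfl⟩
      · rintro I ⟨b, b'⟩
        have : (fun ω => (c I ω, c' I ω)) ⁻¹' {(b, b')} = c I ⁻¹' {b} ∩ c' I ⁻¹' {b'} := by
          ext; simp
        rw [this]
        exact (hc I b).inter (hc' I b')
      · exact fun s => (hD _).union (hD' _)
  have hlow : lowerAlgebra m J r ≤ lowerAlgebra m J (r + 1) :=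
    lowerAlgebra_le_biSup m fun I hI hr => ⟨hI, by omega⟩
  have hgen : lowerAlgebra m J (r + 1) = MeasurableSpace.generateFrom 𝒜 := by
    refine le_antisymm (iSup₂_le fun I hI => ?_) (MeasurableSpace.generateFrom_le ?_)
    · intro S hS
      refine MeasurableSpace.measurableSet_generateFrom ?_
      by_cases hIr : I.card < r
      · exact ⟨Unit, inferInstance, fun _ _ => (), fun _ => S, fun I b => by simp,
          fun _ => le_lowerAlgebra m hI.1 hIr _ hS, rfl⟩
      · have hmem : I ∈ J.powersetCard r :=
          Finset.mem_powersetCard.2 ⟨hI.1, by have := hI.2; omega⟩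
        refine ⟨Prop, inferInstance, fun I' ω => I' = I ∧ ω ∈ S, fun s => {_ω | s ⟨I, hmem⟩},
          ?_, fun s => @MeasurableSet.const _ (_) _, by simp⟩
        intro I' b
        by_cases hI' : I' = I
        · subst hI'
          by_cases hb : b
          · have : (fun ω => I' = I' ∧ ω ∈ S) ⁻¹' {b} = S := by ext; simp [hb]
            rw [this]; exact hS
          · have : (fun ω => I' = I' ∧ ω ∈ S) ⁻¹' {b} = Sᶜ := by ext; simp [hb]
            rw [this]; exact hS.compl
        · have : (fun ω => I' = I ∧ ω ∈ S) ⁻¹' {b} = {_ω | b = False} := by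
            ext; simp [hI', eq_comm]
          rw [this]; exact @MeasurableSet.const _ (_) _
    · rintro S ⟨κ, hκ, c, D, hc, hD, rfl⟩
      have : {ω | ω ∈ D fun I => c I ω} =
          ⋃ s : J.powersetCard r → κ, (⋂ I : J.powersetCard r, c I ⁻¹' {s I}) ∩ D s := by
        ext ω
        simp only [mem_ofPred_eq, mem_iUnion, mem_inter_iff, mem_iInter, mem_preimage,
          mem_singleton_iff]
        constructor
        · exact fun hω => ⟨_, fun _ => rfl, hω⟩
        · rintro ⟨s, hs, hω⟩
          rwa [funext hs]
      rw [this]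
      refine @MeasurableSet.iUnion _ _ (_) _ _ fun s => @MeasurableSet.inter _ (_) _ _
        (@MeasurableSet.iInter _ _ (_) _ _ fun I => ?_) (hlow _ (hD s))
      have hI := Finset.mem_powersetCard.1 I.2
      exact le_lowerAlgebra m hI.1 (by omega) _ (hc _ _)
  have hle := h.lowerAlgebra_le_zero J (r + 1)
  have hdense := @Measure.MeasureDense.of_generateFrom_isSetAlgebra_finite Ω
    (lowerAlgebra m J (r + 1)) (μ.trim hle) 𝒜 (isFiniteMeasure_trim hle) h𝒜 hgen
  have hfin : IsFiniteMeasure (μ.trim hle) := isFiniteMeasure_trim hle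
  obtain ⟨S, hS𝒜, hS⟩ := @Measure.MeasureDense.approx Ω (_) _ _ hdense A hA
    (@measure_ne_top Ω (_) _ hfin A) η hη
  have hSm : MeasurableSet[lowerAlgebra m J (r + 1)] S :=
    @Measure.MeasureDense.measurable Ω (_) _ _ hdense S hS𝒜
  rw [trim_measurableSet_eq hle (hA.symmDiff hSm)] at hS
  obtain ⟨κ, hκ, c, D, hc, hD, rfl⟩ := hS𝒜
  exact ⟨κ, hκ, c, D, hc, hD, (ENNReal.lt_ofReal_iff_toReal_lt (measure_ne_top _ _)).1 hS⟩

end CondIndepSystem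

end CondIndepSystem

section Cells

variable {Ω V : Type} [DecidableEq V] {κ : Type}

/-- The points whose colours on the coordinate sets in `T` are prescribed by `τ`. -/
def colorCell (c : Finset V → Ω → κ) (T : Finset (Finset V)) (τ : Finset V → κ) : Set Ω :=
  ⋂ I ∈ T, c I ⁻¹' {τ I}

theorem mem_colorCell {c : Finset V → Ω → κ} {T : Finset (Finset V)} {τ : Finset V → κ} {ω : Ω} :
    ω ∈ colorCell c T τ ↔ ∀ I ∈ T, c I ω = τ I := by simp [colorCell]

theorem measurableSet_colorCell {n : MeasurableSpace Ω} {c : Finset V → Ω → κ}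
    {T : Finset (Finset V)} {τ : Finset V → κ} (hc : ∀ I ∈ T, ∀ b, MeasurableSet (c I ⁻¹' {b})) :
    MeasurableSet (colorCell c T τ) :=
  Finset.measurableSet_biInter _ fun I hI => hc I hI _

/-- The product of the conditional probabilities of the constraints defining a colour cell on
coordinate sets of size `r`. -/
noncomputable def cellProb {m0 : MeasurableSpace Ω} (μ : Measure Ω)
    (m : Finset V → MeasurableSpace Ω) (r : ℕ) (c : Finset V → Ω → κ) (T : Finset (Finset V))
    (τ : Finset V → κ) (ω : Ω) : ℝ :=
  ∏ I ∈ T, condProb μ (lowerAlgebra m I r) (c I ⁻¹' {τ I}) ω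

variable {m0 : MeasurableSpace Ω} {μ : Measure Ω} {m : Finset V → MeasurableSpace Ω} {r : ℕ}
  {c : Finset V → Ω → κ} {T : Finset (Finset V)} {τ : Finset V → κ}

theorem cellProb_nonneg (ω : Ω) : 0 ≤ cellProb μ m r c T τ ω :=
  Finset.prod_nonneg fun _ _ => condProb_nonneg _ _ _ _

theorem cellProb_le_one (ω : Ω) : cellProb μ m r c T τ ω ≤ 1 :=
  Finset.prod_le_one (fun _ _ => condProb_nonneg _ _ _ _) fun _ _ => condProb_le_one _ _ _ _

theorem measurable_cellProb {n : MeasurableSpace Ω} (h : ∀ I ∈ T, lowerAlgebra m I r ≤ n) :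
    Measurable[n] (cellProb μ m r c T τ) :=
  Finset.measurable_prod _ fun I hI => (measurable_condProb _ _ _).mono (h I hI) le_rfl

theorem lowerAlgebra_succ_le_of_sdiff {J : Finset V}
    (hT : ∀ I ∈ T, I.card = r) :
    lowerAlgebra m J (r + 1) ≤
      ⨆ I ∈ {I : Finset V | I.card < r + 1 ∧ I ∉ T \ J.powersetCard r}, m I := by
  refine lowerAlgebra_le_biSup m fun I hI hr => ⟨hr, fun hc => ?_⟩
  obtain ⟨h1, h2⟩ := Finset.mem_sdiff.1 hc
  exact h2 (Finset.mem_powersetCard.2 ⟨hI, hT I h1⟩)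

theorem biSup_card_lt_le (hT : ∀ I ∈ T, I.card = r) :
    ⨆ I ∈ {I : Finset V | I.card < r}, m I ≤
      ⨆ I ∈ {I : Finset V | I.card < r + 1 ∧ I ∉ T}, m I :=
  biSup_mono fun I hI => ⟨Nat.lt_succ_of_lt hI, fun hI' => (ne_of_lt hI) (hT I hI')⟩

theorem measurableSet_preimage_setOf {n : MeasurableSpace Ω} {ι : Type*} [Finite ι]
    {φ : ι → Set Ω} (hφ : ∀ i, MeasurableSet (φ i)) (s : Set ι) :
    MeasurableSet ((fun ω => {i | ω ∈ φ i}) ⁻¹' {s}) := by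
  have : (fun ω => {i | ω ∈ φ i}) ⁻¹' {s} = ⋂ i, {ω | ω ∈ φ i ↔ i ∈ s} := by
    ext ω
    simp [Set.ext_iff]
  rw [this]
  refine MeasurableSet.iInter fun i => ?_
  by_cases hi : i ∈ s
  · simpa [hi] using hφ i
  · have e : {ω | ω ∈ φ i ↔ i ∈ s} = (φ i)ᶜ := by ext; simp [hi]
    rw [e]
    exact (hφ i).compl

namespace CondIndepSystem

variable [IsProbabilityMeasure μ]

theorem integral_mul_colorCell (h : CondIndepSystem μ m) (hT : ∀ I ∈ T, I.card = r)
    (hc : ∀ I b, MeasurableSet[m I] (c I ⁻¹' {b}))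
    {f : Ω → ℝ} (hf : Measurable[⨆ J ∈ {J : Finset V | J.card < r + 1 ∧ J ∉ T}, m J] f)
    (h0 : ∀ ω, 0 ≤ f ω) (h1 : ∀ ω, f ω ≤ 1) :
    ∫ ω, f ω * (colorCell c T τ).indicator 1 ω ∂μ = ∫ ω, f ω * cellProb μ m r c T τ ω ∂μ := by
  have := h.integral_mul_prod_indicator T hT (B := fun I => c I ⁻¹' {τ I}) (fun I _ => hc I _)
    hf h0 h1
  simp only [prod_indicator_one] at this
  exact this

theorem setIntegral_cellProb (h : CondIndepSystem μ m) (hT : ∀ I ∈ T, I.card = r)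
    (hc : ∀ I b, MeasurableSet[m I] (c I ⁻¹' {b})) {W : Set Ω}
    (hW : MeasurableSet[⨆ I ∈ {I : Finset V | I.card < r}, m I] W) :
    ∫ ω in W, cellProb μ m r c T τ ω ∂μ = μ.real (W ∩ colorCell c T τ) := by
  have hW0 := h.biSup_le _ _ hW
  have hcell : MeasurableSet (colorCell c T τ) :=
    measurableSet_colorCell fun I _ b => h.le I _ (hc I b)
  have e := h.integral_mul_colorCell (τ := τ) hT hc (f := W.indicator 1)
    (measurable_indicator_one (biSup_card_lt_le hT _ hW)) (indicator_one_nonneg W)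
    (indicator_one_le_one W)
  rw [← setIntegral_indicator_one hcell, ← integral_indicator hW0, ← integral_indicator hW0]
  simp only [← indicator_mul_left, Pi.one_apply, one_mul] at e
  exact e.symm

theorem measureReal_cell_pos (h : CondIndepSystem μ m) (hT : ∀ I ∈ T, I.card = r)
    (hc : ∀ I b, MeasurableSet[m I] (c I ⁻¹' {b})) {W : Set Ω}
    (hW : MeasurableSet[⨆ I ∈ {I : Finset V | I.card < r}, m I] W) (hpos : 0 < μ.real W)
    (hp : ∀ I ∈ T, ∀ ω ∈ W, 0 < condProb μ (lowerAlgebra m I r) (c I ⁻¹' {τ I}) ω) :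
    0 < μ.real (W ∩ colorCell c T τ) := by
  have hW0 := h.biSup_le _ _ hW
  rw [← h.setIntegral_cellProb hT hc hW]
  have hi : Integrable (cellProb μ m r c T τ) μ :=
    integrable_of_unit (measurable_cellProb fun I _ => h.lowerAlgebra_le_zero I r)
      cellProb_nonneg cellProb_le_one
  rw [setIntegral_pos_iff_support_of_nonneg_ae (ae_of_all _ cellProb_nonneg) hi.integrableOn]
  have : Function.support (cellProb μ m r c T τ) ∩ W = W :=
    inter_eq_right.2 fun ω hω => (Finset.prod_pos fun I hI => hp I hI ω hω).ne'
  rw [this]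
  exact (measureReal_ne_zero_iff).1 hpos.ne' |>.bot_lt

theorem measureReal_cell_diff_le (h : CondIndepSystem μ m) (hT : ∀ I ∈ T, I.card = r)
    (hc : ∀ I b, MeasurableSet[m I] (c I ⁻¹' {b})) {W : Set Ω}
    (hW : MeasurableSet[⨆ I ∈ {I : Finset V | I.card < r}, m I] W) {J : Finset V}
    (hJT : J.powersetCard r ⊆ T) {A : Set Ω} (hA : MeasurableSet[lowerAlgebra m J (r + 1)] A)
    {θ : ℝ} (hq : ∀ ω ∈ W, condProb μ (lowerAlgebra m J r)
      (Aᶜ ∩ colorCell c (J.powersetCard r) τ) ω ≤ θ * cellProb μ m r c (J.powersetCard r) τ ω) :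
    μ.real ((W ∩ colorCell c T τ) \ A) ≤ θ * μ.real (W ∩ colorCell c T τ) := by
  have hW0 := h.biSup_le _ _ hW
  have hA0 := h.lowerAlgebra_le_zero _ _ _ hA
  have hcell : ∀ T, MeasurableSet (colorCell c T τ) :=
    fun T => measurableSet_colorCell fun I _ b => h.le I _ (hc I b)
  set S := J.powersetCard r with hS
  set B := Aᶜ ∩ colorCell c S τ with hB
  have hBm' : MeasurableSet[lowerAlgebra m J (r + 1)] B := by
    refine hA.compl.inter (measurableSet_colorCell fun I hI b => ?_)
    obtain ⟨h1, h2⟩ := Finset.mem_powersetCard.1 hI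
    exact le_lowerAlgebra m h1 (by omega) _ (hc I b)
  have hBm : MeasurableSet[m J] B := h.lowerAlgebra_le _ _ _ hBm'
  have hT' : ∀ I ∈ T \ S, I.card = r := fun I hI => hT I (Finset.mem_sdiff.1 hI).1
  have hcp : ∀ T, Measurable[m0] (cellProb μ m r c T τ) := fun T =>
    measurable_cellProb fun I _ => h.lowerAlgebra_le_zero I r
  have hlow : ∀ I : Finset V, lowerAlgebra m I r ≤ ⨆ I ∈ {I : Finset V | I.card < r}, m I :=
    fun I => lowerAlgebra_le_biSup m fun _ _ h => h
  have hsplit : ∀ ω, cellProb μ m r c (T \ S) τ ω * cellProb μ m r c S τ ω =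
      cellProb μ m r c T τ ω := fun ω => Finset.prod_sdiff hJT
  have hset : (W ∩ colorCell c T τ) \ A = (W ∩ B) ∩ colorCell c (T \ S) τ := by
    ext ω
    simp only [hB, Set.mem_sdiff, mem_inter_iff, mem_colorCell, mem_compl_iff, Finset.mem_sdiff]
    constructor
    · rintro ⟨⟨h1, h2⟩, h3⟩
      exact ⟨⟨h1, h3, fun I hI => h2 I (hJT hI)⟩, fun I hI => h2 I hI.1⟩
    · rintro ⟨⟨h1, h3, h2⟩, h4⟩
      refine ⟨⟨h1, fun I hI => ?_⟩, h3⟩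
      by_cases hIS : I ∈ S
      · exact h2 I hIS
      · exact h4 I ⟨hI, hIS⟩
  have e1 := h.integral_mul_colorCell (τ := τ) hT' hc (f := (W ∩ B).indicator 1)
    (measurable_indicator_one (MeasurableSet.inter (biSup_card_lt_le hT' _ hW)
      (lowerAlgebra_succ_le_of_sdiff hT _ hBm'))) (indicator_one_nonneg _) (indicator_one_le_one _)
  have e2 := h.integral_mul_condProb (I := J) (r := r) (F := {I : Finset V | I.card < r})
    (fun I hI => lt_of_le_of_lt (Finset.card_le_card Finset.inter_subset_left) hI)
    (fun I _ hI => hI) hBm (f := fun ω => W.indicator 1 ω * cellProb μ m r c (T \ S) τ ω)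
    ((measurable_indicator_one hW).mul (measurable_cellProb fun I _ => hlow I))
    (fun ω => mul_nonneg (indicator_one_nonneg _ _) (cellProb_nonneg _))
    (fun ω => mul_le_one₀ (indicator_one_le_one _ _) (cellProb_nonneg _) (cellProb_le_one _))
  have hI1 : ∀ T, Integrable (fun ω => W.indicator 1 ω * cellProb μ m r c T τ ω) μ := fun T =>
    integrable_of_unit ((measurable_indicator_one hW0).mul (hcp T))
      (fun ω => mul_nonneg (indicator_one_nonneg _ _) (cellProb_nonneg _))
      (fun ω => mul_le_one₀ (indicator_one_le_one _ _) (cellProb_nonneg _) (cellProb_le_one _))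
  have hI2 : Integrable (fun ω => W.indicator 1 ω * cellProb μ m r c (T \ S) τ ω *
      condProb μ (lowerAlgebra m J r) B ω) μ :=
    integrable_of_unit (((measurable_indicator_one hW0).mul (hcp _)).mul
        ((measurable_condProb _ _ _).mono (h.lowerAlgebra_le_zero _ _) le_rfl))
      (fun ω => mul_nonneg (mul_nonneg (indicator_one_nonneg _ _) (cellProb_nonneg _))
        (condProb_nonneg _ _ _ _))
      (fun ω => mul_le_one₀ (mul_le_one₀ (indicator_one_le_one _ _) (cellProb_nonneg _)
        (cellProb_le_one _)) (condProb_nonneg _ _ _ _) (condProb_le_one _ _ _ _))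
  calc μ.real ((W ∩ colorCell c T τ) \ A)
      = ∫ ω, (W ∩ B).indicator 1 ω * (colorCell c (T \ S) τ).indicator 1 ω ∂μ := by
        rw [hset, ← integral_indicator_one ((hW0.inter (h.le _ _ hBm)).inter (hcell _)),
          inter_indicator_one]
        rfl
    _ = ∫ ω, W.indicator 1 ω * cellProb μ m r c (T \ S) τ ω *
          condProb μ (lowerAlgebra m J r) B ω ∂μ := by
        rw [e1, ← e2]
        congr 1; ext ω
        rw [inter_indicator_one, Pi.mul_apply]
        ring
    _ ≤ ∫ ω, θ * (W.indicator 1 ω * cellProb μ m r c T τ ω) ∂μ := by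
        refine integral_mono hI2 ((hI1 T).const_mul θ) fun ω => ?_
        by_cases hω : ω ∈ W
        · have := mul_le_mul_of_nonneg_left (hq ω hω)
            (cellProb_nonneg (μ := μ) (m := m) (r := r) (c := c) (T := T \ S) (τ := τ) ω)
          simp only [indicator_of_mem hω, Pi.one_apply, one_mul]
          rw [← hsplit]
          linarith
        · simp [indicator_of_notMem hω]
    _ = θ * μ.real (W ∩ colorCell c T τ) := by
        rw [integral_const_mul, ← h.setIntegral_cellProb hT hc hW, ← integral_indicator hW0]
        simp only [← indicator_mul_left, Pi.one_apply, one_mul]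

end CondIndepSystem

end Cells

section Removal

variable {Ω V : Type} [DecidableEq V] {κ : Type} {m0 : MeasurableSpace Ω} {μ : Measure Ω}
  {m : Finset V → MeasurableSpace Ω} {r : ℕ} {c : Finset V → Ω → κ}

/-- The points of `A` at which the density of `A` within the colour cell, given the coordinate
sets of size less than `r`, is not close to one. -/
def lowDensity {m0 : MeasurableSpace Ω} (μ : Measure Ω) (m : Finset V → MeasurableSpace Ω)
    (r : ℕ) (c : Finset V → Ω → κ) (J : Finset V) (θ : ℝ) (A : Set Ω) : Set Ω :=
  A ∩ {ω | θ * cellProb μ m r c (J.powersetCard r) (fun I => c I ω) ω <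
    condProb μ (lowerAlgebra m J r)
      (Aᶜ ∩ colorCell c (J.powersetCard r) fun I => c I ω) ω}

/-- The points at which their own colour has zero conditional probability. -/
def nullColor {m0 : MeasurableSpace Ω} (μ : Measure Ω) (m : Finset V → MeasurableSpace Ω)
    (r : ℕ) (c : Finset V → Ω → κ) (J : Finset V) : Set Ω :=
  {ω | condProb μ (lowerAlgebra m J r) (c J ⁻¹' {c J ω}) ω ≤ 0}

theorem colorCell_congr {T : Finset (Finset V)} {τ τ' : Finset V → κ}
    (h : ∀ I ∈ T, τ I = τ' I) : colorCell c T τ = colorCell c T τ' := by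
  ext ω
  simp only [mem_colorCell]
  exact forall₂_congr fun I hI => by rw [h I hI]

theorem cellProb_congr {T : Finset (Finset V)} {τ τ' : Finset V → κ}
    (h : ∀ I ∈ T, τ I = τ' I) : cellProb μ m r c T τ = cellProb μ m r c T τ' := by
  ext ω
  exact Finset.prod_congr rfl fun I hI => by rw [h I hI]

namespace CondIndepSystem

variable [IsProbabilityMeasure μ]

theorem measurableSet_lowDensity (h : CondIndepSystem μ m) [Finite V] [Finite κ]
    (hc : ∀ I b, MeasurableSet[m I] (c I ⁻¹' {b})) {J : Finset V} {A : Set Ω}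
    (hA : MeasurableSet[m J] A) (θ : ℝ) : MeasurableSet[m J] (lowDensity μ m r c J θ A) := by
  have hcJ : ∀ I ∈ J.powersetCard r, ∀ b, MeasurableSet[m J] (c I ⁻¹' {b}) := fun I hI b =>
    h.mono (Finset.mem_powersetCard.1 hI).1 _ (hc I b)
  have e : lowDensity μ m r c J θ A = ⋃ τ : Finset V → κ,
      (A ∩ colorCell c (J.powersetCard r) τ) ∩
        {ω | θ * cellProb μ m r c (J.powersetCard r) τ ω <
          condProb μ (lowerAlgebra m J r) (Aᶜ ∩ colorCell c (J.powersetCard r) τ) ω} := by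
    ext ω
    simp only [lowDensity, mem_inter_iff, mem_ofPred_eq, mem_iUnion]
    constructor
    · rintro ⟨h1, h2⟩
      exact ⟨fun I => c I ω, ⟨h1, mem_colorCell.2 fun _ _ => rfl⟩, h2⟩
    · rintro ⟨τ, ⟨h1, h2⟩, h3⟩
      rw [mem_colorCell] at h2
      rw [cellProb_congr h2, colorCell_congr h2]
      exact ⟨h1, h3⟩
  rw [e]
  refine MeasurableSet.iUnion fun τ => (hA.inter (measurableSet_colorCell hcJ)).inter
    (measurableSet_lt (Measurable.const_mul ?_ θ)
      ((measurable_condProb _ _ _).mono (h.lowerAlgebra_le _ _) le_rfl))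
  exact measurable_cellProb fun I hI => (h.lowerAlgebra_le I r).trans
    (h.mono (Finset.mem_powersetCard.1 hI).1)

theorem measureReal_lowDensity_le (h : CondIndepSystem μ m) [Finite κ]
    (hc : ∀ I b, MeasurableSet[m I] (c I ⁻¹' {b})) {J : Finset V} {A : Set Ω}
    (hA : MeasurableSet A) {D : (J.powersetCard r → κ) → Set Ω}
    (hD : ∀ s, MeasurableSet[lowerAlgebra m J r] (D s)) {θ : ℝ} (hθ : 0 < θ) :
    μ.real (lowDensity μ m r c J θ A) ≤
      (1 + θ⁻¹) * μ.real (symmDiff A {ω | ω ∈ D fun I => c I ω}) := by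
  classical
  have hne : Nonempty Ω := nonempty_of_isProbabilityMeasure μ
  obtain ⟨ω₀⟩ := hne
  set S := J.powersetCard r with hS
  let ext : (S → κ) → Finset V → κ := fun s I => if hI : I ∈ S then s ⟨I, hI⟩ else c ∅ ω₀
  have hext : ∀ s (I : S), ext s I = s I := fun s I => by simp [ext]
  let e : Ω → S → κ := fun ω I => c I ω
  have hexte : ∀ ω, ∀ I ∈ S, ext (e ω) I = c I ω := fun ω I hI => hext (e ω) ⟨I, hI⟩
  have hpre : ∀ s, e ⁻¹' {s} = colorCell c S (ext s) := by
    intro s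
    ext ω
    rw [mem_preimage, mem_singleton_iff, mem_colorCell, funext_iff, Subtype.forall]
    refine forall₂_congr fun I hI => ?_
    rw [hext s ⟨I, hI⟩]
  have hcell : ∀ s, MeasurableSet (e ⁻¹' {s}) := fun s => by
    rw [hpre]
    exact measurableSet_colorCell fun I _ b => h.le I _ (hc I b)
  have hlow := h.lowerAlgebra_le_zero J r
  have hSr : ∀ I ∈ S, I.card = r := fun I hI => (Finset.mem_powersetCard.1 hI).2
  have hpm : ∀ s, Measurable[lowerAlgebra m J r] (cellProb μ m r c S (ext s)) := fun s =>
    measurable_cellProb fun I hI => lowerAlgebra_le_biSup m fun I' hI' hr =>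
      ⟨hI'.trans (Finset.mem_powersetCard.1 hI).1, hr⟩
  have hqm : ∀ s, Measurable[lowerAlgebra m J r]
      (condProb μ (lowerAlgebra m J r) (Aᶜ ∩ e ⁻¹' {s})) := fun s => measurable_condProb _ _ _
  have key := measureReal_low_density_le (μ := μ) hlow hcell hA hD hpm hqm
    (fun s => integrable_of_unit ((hpm s).mono hlow le_rfl) cellProb_nonneg cellProb_le_one)
    (fun s => integrable_of_unit ((hqm s).mono hlow le_rfl) (condProb_nonneg _ _ _)
      (condProb_le_one _ _ _))
    (fun s W hW => by
      rw [hpre]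
      exact h.setIntegral_cellProb hSr hc (lowerAlgebra_le_biSup m (fun I _ hI => hI) _ hW))
    (fun s W hW => setIntegral_condProb hlow (hA.compl.inter (hcell s)) hW) hθ
  refine le_trans (measureReal_mono ?_) key
  rintro ω ⟨h1, h2⟩
  refine ⟨h1, ?_⟩
  simp only [mem_ofPred_eq] at h2 ⊢
  rw [hpre, cellProb_congr (hexte ω), colorCell_congr (hexte ω)]
  exact h2

theorem nullColor_eq (J : Finset V) : nullColor μ m r c J =
    ⋃ b, c J ⁻¹' {b} ∩ {ω | condProb μ (lowerAlgebra m J r) (c J ⁻¹' {b}) ω ≤ 0} := by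
  ext ω
  simp only [nullColor, mem_iUnion, mem_inter_iff, mem_preimage, mem_singleton_iff, mem_ofPred_eq]
  constructor
  · exact fun h => ⟨_, rfl, h⟩
  · rintro ⟨b, rfl, h⟩
    exact h

theorem measurableSet_nullColor (h : CondIndepSystem μ m) [Finite κ]
    (hc : ∀ I b, MeasurableSet[m I] (c I ⁻¹' {b})) (J : Finset V) :
    MeasurableSet[m J] (nullColor μ m r c J) := by
  rw [nullColor_eq]
  exact MeasurableSet.iUnion fun b => (hc J b).inter
    (measurableSet_le ((measurable_condProb _ _ _).mono (h.lowerAlgebra_le _ _) le_rfl)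
      measurable_const)

theorem measureReal_nullColor (h : CondIndepSystem μ m) [Finite κ]
    (hc : ∀ I b, MeasurableSet[m I] (c I ⁻¹' {b})) (J : Finset V) :
    μ.real (nullColor μ m r c J) = 0 := by
  have hlow := h.lowerAlgebra_le_zero J r
  rw [nullColor_eq, measureReal_eq_zero_iff, measure_iUnion_null_iff]
  intro b
  rw [← measureReal_eq_zero_iff]
  refine le_antisymm ?_ measureReal_nonneg
  have hm : MeasurableSet[lowerAlgebra m J r]
      {ω | condProb μ (lowerAlgebra m J r) (c J ⁻¹' {b}) ω ≤ 0} :=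
    measurableSet_le (measurable_condProb _ _ _) measurable_const
  rw [inter_comm, ← setIntegral_condProb hlow (h.le _ _ (hc J b)) hm]
  exact setIntegral_nonpos (hlow _ hm) fun ω hω => hω

theorem exists_approx_family (h : CondIndepSystem μ m) [Finite κ] (𝒥 : Finset (Finset V)) (r : ℕ)
    {a : Finset V → Ω → κ}
    (ha : ∀ J ∈ 𝒥, ∀ b, MeasurableSet[lowerAlgebra m J (r + 1)] (a J ⁻¹' {b}))
    {η : ℝ} (hη : 0 < η) :
    ∃ (κ' : Type) (_ : Finite κ') (c : Finset V → Ω → κ'),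
      (∀ I b, MeasurableSet[m I] (c I ⁻¹' {b})) ∧
      ∀ J ∈ 𝒥, ∀ b, ∃ D : (J.powersetCard r → κ') → Set Ω,
        (∀ s, MeasurableSet[lowerAlgebra m J r] (D s)) ∧
        μ.real (symmDiff (a J ⁻¹' {b}) {ω | ω ∈ D fun I => c I ω}) < η := by
  choose κ' hκ' c D hc hD hη' using fun (p : 𝒥 × κ) =>
    h.exists_approx p.1.1 r (ha p.1.1 p.1.2 p.2) hη
  refine ⟨∀ p, κ' p, inferInstance, fun I ω p => c p I ω, fun I b => ?_, fun J hJ b =>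
    ⟨fun s => D (⟨J, hJ⟩, b) fun I => s I (⟨J, hJ⟩, b), fun s => hD _ _, hη' (⟨J, hJ⟩, b)⟩⟩
  have e : (fun ω p => c p I ω) ⁻¹' {b} = ⋂ p, c p I ⁻¹' {b p} := by
    ext ω
    simp [funext_iff]
  rw [e]
  exact MeasurableSet.iInter fun p => hc p I _

/-- Outside a small exceptional set for each coordinate set, every combination of colours which
occurs at a point occurs with positive probability. -/
theorem exists_removal (h : CondIndepSystem μ m) [Finite V] {𝒥 : Finset (Finset V)}
    (h𝒥 : ∀ J ∈ 𝒥, ∀ I ⊆ J, I ∈ 𝒥) (r : ℕ) {κ : Type} [Finite κ] {a : Finset V → Ω → κ}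
    (ha : ∀ J ∈ 𝒥, ∀ b, MeasurableSet[lowerAlgebra m J r] (a J ⁻¹' {b})) {ε : ℝ} (hε : 0 < ε) :
    ∃ Z : Finset V → Set Ω, (∀ J ∈ 𝒥, MeasurableSet[m J] (Z J) ∧ μ.real (Z J) ≤ ε) ∧
      ∀ ω, (∀ J ∈ 𝒥, ω ∉ Z J) → 0 < μ.real (⋂ J ∈ 𝒥, a J ⁻¹' {a J ω}) := by
  induction r generalizing κ ε with
  | zero =>
    refine ⟨fun _ => ∅, fun J _ => ⟨@MeasurableSet.empty _ (m J), by simpa using hε.le⟩,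
      fun ω _ => ?_⟩
    have e : ⋂ J ∈ 𝒥, a J ⁻¹' {a J ω} = univ := by
      simp only [iInter_eq_univ]
      intro J hJ
      have h1 := ha J hJ (a J ω)
      have h2 : lowerAlgebra m J 0 = ⊥ := by simp [lowerAlgebra]
      rw [h2, MeasurableSpace.measurableSet_bot_iff] at h1
      refine h1.resolve_left fun h3 => ?_
      have h4 : ω ∈ a J ⁻¹' {a J ω} := rfl
      rw [h3] at h4
      exact h4
    rw [e]
    simp
  | succ r ih =>
    classical
    have := Fintype.ofFinite κ
    set θ : ℝ := 1 / (2 * (𝒥.card + 1)) with hθ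
    have hθ0 : 0 < θ := by positivity
    set η : ℝ := ε / (2 * (Fintype.card κ + 1) * (1 + θ⁻¹)) with hη
    have hη0 : 0 < η := by positivity
    obtain ⟨κ', _, c, hc, hD⟩ := h.exists_approx_family 𝒥 r ha hη0
    let G : Finset V → κ × (Finset V → κ') → Set Ω := fun J x =>
      {ω | condProb μ (lowerAlgebra m J r)
        ((a J ⁻¹' {x.1})ᶜ ∩ colorCell c (J.powersetCard r) x.2) ω ≤
        θ * cellProb μ m r c (J.powersetCard r) x.2 ω}
    let P : Finset V → κ' → Set Ω := fun J b =>
      {ω | 0 < condProb μ (lowerAlgebra m J r) (c J ⁻¹' {b}) ω}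
    let φ : Finset V → (κ × (Finset V → κ')) ⊕ κ' → Set Ω := fun J => Sum.elim (G J) (P J)
    have hφ : ∀ J i, MeasurableSet[lowerAlgebra m J r] (φ J i) := by
      rintro J (x | b)
      · refine measurableSet_le (measurable_condProb _ _ _) (Measurable.const_mul ?_ θ)
        exact measurable_cellProb fun I hI => lowerAlgebra_le_biSup m fun I' hI' hr =>
          ⟨hI'.trans (Finset.mem_powersetCard.1 hI).1, hr⟩
      · exact measurableSet_lt measurable_const (measurable_condProb _ _ _)
    let a' : Finset V → Ω → Set ((κ × (Finset V → κ')) ⊕ κ') := fun J ω => {i | ω ∈ φ J i}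
    have ha' : ∀ J s, MeasurableSet[lowerAlgebra m J r] (a' J ⁻¹' {s}) := fun J s =>
      measurableSet_preimage_setOf (hφ J) s
    obtain ⟨Z', hZ', hpos⟩ := ih (a := a') (fun J _ => ha' J) (half_pos hε)
    have haJ : ∀ J ∈ 𝒥, ∀ b, MeasurableSet[m J] (a J ⁻¹' {b}) := fun J hJ b =>
      h.lowerAlgebra_le _ _ _ (ha J hJ b)
    refine ⟨fun J => Z' J ∪ (⋃ b, lowDensity μ m r c J θ (a J ⁻¹' {b})) ∪ nullColor μ m r c J,
      fun J hJ => ⟨?_, ?_⟩, fun ω hω => ?_⟩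
    · exact ((hZ' J hJ).1.union (MeasurableSet.iUnion fun b =>
        h.measurableSet_lowDensity hc (haJ J hJ b) θ)).union (h.measurableSet_nullColor hc J)
    · have h1 : μ.real (⋃ b, lowDensity μ m r c J θ (a J ⁻¹' {b})) ≤ ε / 2 :=
        calc _ ≤ ∑ b, μ.real (lowDensity μ m r c J θ (a J ⁻¹' {b})) :=
              measureReal_iUnion_fintype_le _
          _ ≤ ∑ _b : κ, (1 + θ⁻¹) * η := by
              refine Finset.sum_le_sum fun b _ => ?_
              obtain ⟨D, hDm, hDη⟩ := hD J hJ b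
              refine (h.measureReal_lowDensity_le hc (h.le _ _ (haJ J hJ b)) hDm hθ0).trans ?_
              gcongr
          _ = Fintype.card κ * ((1 + θ⁻¹) * η) := by simp
          _ ≤ (Fintype.card κ + 1) * ((1 + θ⁻¹) * η) := by gcongr; linarith
          _ = ε / 2 := by rw [hη]; field_simp
      calc _ ≤ μ.real (Z' J) + μ.real (⋃ b, lowDensity μ m r c J θ (a J ⁻¹' {b})) +
            μ.real (nullColor μ m r c J) :=
            (measureReal_union_le _ _).trans (by gcongr; exact measureReal_union_le _ _)
        _ ≤ ε / 2 + ε / 2 + 0 := by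
            gcongr
            · exact (hZ' J hJ).2
            · exact (h.measureReal_nullColor hc J).le
        _ = ε := by ring
    · simp only [mem_union, not_or, mem_iUnion, not_exists] at hω
      have hWpos := hpos ω fun J hJ => (hω J hJ).1.1
      set W := ⋂ J ∈ 𝒥, a' J ⁻¹' {a' J ω} with hW
      have hWφ : ∀ J ∈ 𝒥, ∀ i, ω ∈ φ J i → ∀ ω' ∈ W, ω' ∈ φ J i := by
        intro J hJ i hi ω' hω'
        have h1 : a' J ω' = a' J ω := mem_iInter₂.1 hω' J hJ
        have h2 : i ∈ a' J ω := hi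
        rw [← h1] at h2
        exact h2
      have hWm : MeasurableSet[⨆ I ∈ {I : Finset V | I.card < r}, m I] W :=
        Finset.measurableSet_biInter _ fun J _ =>
          lowerAlgebra_le_biSup m (fun I _ hI => hI) _ (ha' J _)
      let T := 𝒥.filter fun I => I.card = r
      have hT : ∀ I ∈ T, I.card = r := fun I hI => (Finset.mem_filter.1 hI).2
      let τ : Finset V → κ' := fun I => c I ω
      have hCpos : 0 < μ.real (W ∩ colorCell c T τ) := by
        refine h.measureReal_cell_pos hT hc hWm hWpos fun I hI ω' hω' => ?_
        have hI𝒥 := (Finset.mem_filter.1 hI).1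
        refine hWφ I hI𝒥 (Sum.inr (c I ω)) ?_ ω' hω'
        by_contra h1
        have h2 : condProb μ (lowerAlgebra m I r) (c I ⁻¹' {c I ω}) ω ≤ 0 := not_lt.1 h1
        exact (hω I hI𝒥).2 h2
      have hdiff : ∀ J ∈ 𝒥, μ.real ((W ∩ colorCell c T τ) \ a J ⁻¹' {a J ω}) ≤
          θ * μ.real (W ∩ colorCell c T τ) := by
        intro J hJ
        refine h.measureReal_cell_diff_le hT hc hWm (fun I hI => ?_) (ha J hJ _)
          (fun ω' hω' => ?_)
        · obtain ⟨h1, h2⟩ := Finset.mem_powersetCard.1 hI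
          exact Finset.mem_filter.2 ⟨h𝒥 J hJ I h1, h2⟩
        · refine hWφ J hJ (Sum.inl (a J ω, τ)) ?_ ω' hω'
          by_contra h1
          have h2 : θ * cellProb μ m r c (J.powersetCard r) τ ω <
            condProb μ (lowerAlgebra m J r)
              ((a J ⁻¹' {a J ω})ᶜ ∩ colorCell c (J.powersetCard r) τ) ω := not_le.1 h1
          exact (hω J hJ).1.2 (a J ω) ⟨rfl, h2⟩
      have hsub : W ∩ colorCell c T τ ⊆ (⋂ J ∈ 𝒥, a J ⁻¹' {a J ω}) ∪
          ⋃ J ∈ 𝒥, (W ∩ colorCell c T τ) \ a J ⁻¹' {a J ω} := by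
        intro ω' hω'
        by_cases hall : ω' ∈ ⋂ J ∈ 𝒥, a J ⁻¹' {a J ω}
        · exact Or.inl hall
        · right
          simp only [mem_iInter, not_forall] at hall
          obtain ⟨J, hJ, hn⟩ := hall
          exact mem_iUnion₂.2 ⟨J, hJ, hω', hn⟩
      have hbound : μ.real (W ∩ colorCell c T τ) ≤ μ.real (⋂ J ∈ 𝒥, a J ⁻¹' {a J ω}) +
          𝒥.card * (θ * μ.real (W ∩ colorCell c T τ)) :=
        calc _ ≤ μ.real (⋂ J ∈ 𝒥, a J ⁻¹' {a J ω}) +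
              ∑ J ∈ 𝒥, μ.real ((W ∩ colorCell c T τ) \ a J ⁻¹' {a J ω}) :=
              (measureReal_mono hsub).trans ((measureReal_union_le _ _).trans
                (by gcongr; exact measureReal_biUnion_finset_le _ _))
          _ ≤ μ.real (⋂ J ∈ 𝒥, a J ⁻¹' {a J ω}) +
              ∑ _J ∈ 𝒥, θ * μ.real (W ∩ colorCell c T τ) := by
              gcongr with J hJ
              exact hdiff J hJ
          _ = _ := by simp
      have hθ1 : 𝒥.card * θ ≤ 1 / 2 := by
        rw [hθ, mul_one_div, div_le_iff₀ (by positivity)]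
        linarith
      nlinarith [mul_le_mul_of_nonneg_right hθ1 hCpos.le]

/-- Sets on the top-dimensional faces of the simplex with null intersection have empty
intersection after removing small sets. -/
theorem exists_removal_of_measureReal_eq_zero [Fintype V] (h : CondIndepSystem μ m)
    {E : V → Set Ω} (hE : ∀ i, MeasurableSet[m (Finset.univ.erase i)] (E i))
    (hμ : μ.real (⋂ i, E i) = 0) {ε : ℝ} (hε : 0 < ε) :
    ∃ Z : V → Set Ω, (∀ i, MeasurableSet[m (Finset.univ.erase i)] (Z i)) ∧
      (∀ i, μ.real (Z i) ≤ ε) ∧ ∀ ω, ∃ i, ω ∉ E i ∨ ω ∈ Z i := by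
  classical
  set 𝒥 : Finset (Finset V) := Finset.univ.filter fun J => J ≠ Finset.univ with h𝒥
  have hmem : ∀ J : Finset V, J ∈ 𝒥 ↔ ∃ i, J ⊆ Finset.univ.erase i := by
    intro J
    simp only [h𝒥, Finset.mem_filter, Finset.mem_univ, true_and, ne_eq, Finset.subset_erase,
      Finset.subset_univ, Finset.eq_univ_iff_forall, not_forall]
  have hcard : ∀ J ∈ 𝒥, J.card < Fintype.card V := fun J hJ =>
    (Finset.card_lt_iff_ne_univ J).2 (Finset.mem_filter.1 hJ).2
  let a : Finset V → Ω → Set V := fun J ω => {i | J = Finset.univ.erase i ∧ ω ∈ E i}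
  have ha : ∀ J ∈ 𝒥, ∀ b,
      MeasurableSet[lowerAlgebra m J (Fintype.card V)] (a J ⁻¹' {b}) := by
    intro J hJ b
    refine le_lowerAlgebra m subset_rfl (hcard J hJ) _ ?_
    refine measurableSet_preimage_setOf (φ := fun i => {ω | J = Finset.univ.erase i ∧ ω ∈ E i})
      (fun i => ?_) b
    by_cases hJi : J = Finset.univ.erase i
    · subst hJi
      simpa using hE i
    · simp [hJi]
  set N : ℝ := (𝒥.card : ℝ) + 1 with hN
  have hN0 : 0 < N := by positivity
  obtain ⟨Z, hZ, hpos⟩ := h.exists_removal (𝒥 := 𝒥)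
    (fun J hJ I hI => (hmem I).2 (((hmem J).1 hJ).imp fun _ => hI.trans)) _ ha (div_pos hε hN0)
  refine ⟨fun i => ⋃ J ∈ 𝒥.filter fun J => J ⊆ Finset.univ.erase i, Z J, fun i => ?_, fun i => ?_,
    fun ω => ?_⟩
  · refine Finset.measurableSet_biUnion _ fun J hJ => ?_
    obtain ⟨h1, h2⟩ := Finset.mem_filter.1 hJ
    exact h.mono h2 _ (hZ J h1).1
  · calc _ ≤ ∑ J ∈ 𝒥.filter fun J => J ⊆ Finset.univ.erase i, μ.real (Z J) :=
          measureReal_biUnion_finset_le _ _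
      _ ≤ ∑ J ∈ 𝒥, μ.real (Z J) :=
          Finset.sum_le_sum_of_subset_of_nonneg (Finset.filter_subset _ _)
            fun _ _ _ => measureReal_nonneg
      _ ≤ ∑ _J ∈ 𝒥, ε / N := Finset.sum_le_sum fun J hJ => (hZ J hJ).2
      _ = 𝒥.card * (ε / N) := by simp
      _ ≤ N * (ε / N) := by gcongr; linarith
      _ = ε := by field_simp
  · by_contra! hc
    refine (hpos ω fun J hJ hω => ?_).not_ge ?_
    · obtain ⟨i, hi⟩ := (hmem J).1 hJ
      exact (hc i).2 (mem_iUnion₂.2 ⟨J, Finset.mem_filter.2 ⟨hJ, hi⟩, hω⟩)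
    · rw [← hμ]
      refine measureReal_mono fun ω' hω' => mem_iInter.2 fun i => ?_
      have h1 : a (Finset.univ.erase i) ω' = a (Finset.univ.erase i) ω :=
        mem_iInter₂.1 hω' _ ((hmem _).2 ⟨i, subset_rfl⟩)
      have h2 : i ∈ a (Finset.univ.erase i) ω := ⟨rfl, (hc i).1⟩
      rw [← h1] at h2
      exact h2.2

end CondIndepSystem

end Removal

section UltrafilterSpace

instance Ultrafilter.instMeasurableSpaceBorel {α : Type*} : MeasurableSpace (Ultrafilter α) :=
  borel _

instance Ultrafilter.instBorelSpace {α : Type*} : BorelSpace (Ultrafilter α) := ⟨rfl⟩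

variable {α β : Type}

theorem Ultrafilter.continuous_map (π : α → β) : Continuous (Ultrafilter.map π) := by
  refine ultrafilterBasis_is_basis.continuous_iff.2 ?_
  rintro _ ⟨s, rfl⟩
  exact ultrafilter_isOpen_basic (π ⁻¹' s)

/-- The continuous extension of a `[-1, 1]`-valued function to the space of ultrafilters. -/
noncomputable def unitExtend (h : α → Icc (-1 : ℝ) 1) (u : Ultrafilter α) : ℝ :=
  (Ultrafilter.extend h u : Icc (-1 : ℝ) 1)

theorem continuous_unitExtend (h : α → Icc (-1 : ℝ) 1) : Continuous (unitExtend h) :=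
  continuous_subtype_val.comp (continuous_ultrafilter_extend h)

theorem unitExtend_pure (h : α → Icc (-1 : ℝ) 1) (a : α) : unitExtend h (pure a) = h a := by
  rw [unitExtend, ultrafilter_extend_pure]

theorem abs_unitExtend_le (h : α → Icc (-1 : ℝ) 1) (u : Ultrafilter α) : |unitExtend h u| ≤ 1 :=
  abs_le.2 (Ultrafilter.extend h u : Icc (-1 : ℝ) 1).2

theorem measurable_unitExtend (h : α → Icc (-1 : ℝ) 1) : Measurable (unitExtend h) :=
  (continuous_unitExtend h).measurable

theorem exists_unitExtend_approx {ν : Measure (Ultrafilter α)} [IsFiniteMeasure ν] [ν.Regular]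
    (π : α → β) {φ : Ultrafilter α → ℝ}
    (hφ : Measurable[MeasurableSpace.comap (Ultrafilter.map π) inferInstance] φ)
    (hb : ∀ u, |φ u| ≤ 1) {η : ℝ} (hη : 0 < η) :
    ∃ h : β → Icc (-1 : ℝ) 1, ∫ u, |φ u - unitExtend h (u.map π)| ∂ν ≤ η := by
  obtain ⟨ψ, hψ, rfl⟩ := hφ.exists_eq_measurable_comp
  have hc := Ultrafilter.continuous_map π
  have hm := hc.measurable
  have : (ν.map (Ultrafilter.map π)).InnerRegularCompactLTTop :=
    Measure.InnerRegularCompactLTTop.map_of_continuous hc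
  have hint : Integrable ψ (ν.map (Ultrafilter.map π)) := by
    rw [integrable_map_measure hψ.aestronglyMeasurable hm.aemeasurable]
    exact Integrable.of_bound (hψ.comp hm).aestronglyMeasurable 1 (ae_of_all _ hb)
  obtain ⟨g, hg, hgi⟩ := hint.exists_boundedContinuous_integral_sub_le hη
  let G : Ultrafilter β → Icc (-1 : ℝ) 1 := fun u => projIcc (-1) 1 (by norm_num) (g u)
  have hG : Continuous G := continuous_projIcc.comp g.continuous
  refine ⟨fun b => G (pure b), le_trans ?_ hg⟩
  have hext : Ultrafilter.extend (fun b => G (pure b)) = G :=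
    denseRange_pure.equalizer (continuous_ultrafilter_extend _) hG (ultrafilter_extend_extends _)
  have hle : ∀ u : Ultrafilter α,
      |ψ (u.map π) - unitExtend (fun b => G (pure b)) (u.map π)| ≤ ‖ψ (u.map π) - g (u.map π)‖ := by
    intro u
    have h1 := abs_le.1 (hb u)
    simp only [Function.comp] at h1
    rw [unitExtend, hext, Real.norm_eq_abs]
    simp only [G, coe_projIcc]
    rcases le_total (g (u.map π)) (-1) with h2 | h2
    · rw [min_eq_right (by linarith), max_eq_left h2, abs_of_nonneg (by linarith),
        abs_of_nonneg (by linarith)]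
      linarith
    · rcases le_total (g (u.map π)) 1 with h3 | h3
      · rw [min_eq_right h3, max_eq_right h2]
      · rw [min_eq_left h3, max_eq_right (by norm_num), abs_of_nonpos (by linarith),
          abs_of_nonpos (by linarith)]
        linarith
  have hsub : Integrable (fun v => ‖ψ v - g v‖) (ν.map (Ultrafilter.map π)) := (hint.sub hgi).norm
  rw [integral_map hm.aemeasurable hsub.aestronglyMeasurable]
  refine integral_mono_of_nonneg (ae_of_all _ fun _ => abs_nonneg _) ?_ (ae_of_all _ hle)
  exact (integrable_map_measure hsub.aestronglyMeasurable hm.aemeasurable).1 hsub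

/-- A sequence of discrete probability measures has a regular limit on the space of
ultrafilters. -/
theorem exists_regular_limit {ι : ℕ → Type} [∀ n, Fintype (ι n)] (p : ∀ n, ι n → ℝ)
    (hp : ∀ n x, 0 ≤ p n x) (hp1 : ∀ n, ∑ x, p n x = 1) (e : ∀ n, ι n → α) :
    ∃ ν : Measure (Ultrafilter α), IsProbabilityMeasure ν ∧ ν.Regular ∧
      ∀ G : Ultrafilter α → ℝ, Continuous G →
        Tendsto (fun n => ∑ x, p n x * G (pure (e n x))) (hyperfilter ℕ) (𝓝 (∫ u, G u ∂ν)) := by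
  let P : ℕ → Measure (Ultrafilter α) := fun n =>
    ∑ x, ENNReal.ofReal (p n x) • Measure.dirac (pure (e n x))
  have hP : ∀ n, IsProbabilityMeasure (P n) := fun n => ⟨by
    simp only [P, Measure.coe_finsetSum, Finset.sum_apply, Measure.smul_apply, measure_univ,
      smul_eq_mul, mul_one]
    rw [← ENNReal.ofReal_sum_of_nonneg fun x _ => hp n x, hp1, ENNReal.ofReal_one]⟩
  have hPint : ∀ n (G : Ultrafilter α → ℝ), Continuous G →
      ∫ u, G u ∂(P n) = ∑ x, p n x * G (pure (e n x)) := by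
    intro n G hG
    rw [integral_finsetSum_measure]
    · refine Finset.sum_congr rfl fun x _ => ?_
      rw [integral_smul_measure, integral_dirac' _ _ hG.measurable.stronglyMeasurable,
        ENNReal.toReal_ofReal (hp n x), smul_eq_mul]
    · intro x _
      exact ((integrable_dirac' hG.measurable.stronglyMeasurable
        (by simp [enorm_lt_top]))).smul_measure ENNReal.ofReal_ne_top
  let Q : ℕ → ProbabilityMeasure (Ultrafilter α) := fun n => ⟨P n, hP n⟩
  let U : Ultrafilter (ProbabilityMeasure (Ultrafilter α)) := (hyperfilter ℕ).map Q
  have hU : Tendsto Q (hyperfilter ℕ) (𝓝 U.lim) := U.le_nhds_lim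
  rw [ProbabilityMeasure.tendsto_iff_forall_integral_tendsto] at hU
  obtain ⟨ν, hreg, hfin, hν⟩ :=
    Measure.exists_regular_eq_of_compactSpace (U.lim : Measure (Ultrafilter α))
  refine ⟨ν, ⟨?_⟩, hreg, fun G hG => ?_⟩
  · have h1 := hν (BoundedContinuousFunction.const _ 1)
    simp only [BoundedContinuousFunction.const_apply, integral_const, smul_eq_mul, mul_one,
      probReal_univ] at h1
    rw [measureReal_def] at h1
    rw [← ENNReal.ofReal_toReal (measure_ne_top ν univ), ← h1, ENNReal.ofReal_one]
  · have h1 := hU (BoundedContinuousFunction.mkOfCompact ⟨G, hG⟩)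
    rw [hν] at h1
    simp only [BoundedContinuousFunction.mkOfCompact_apply, ContinuousMap.coe_mk] at h1
    refine h1.congr fun n => ?_
    exact hPint n G hG

theorem abs_prod_sub_prod_le {ι : Type*} (t : Finset ι) {a b : ι → ℝ}
    (ha : ∀ i ∈ t, |a i| ≤ 1) (hb : ∀ i ∈ t, |b i| ≤ 1) :
    |∏ i ∈ t, a i - ∏ i ∈ t, b i| ≤ ∑ i ∈ t, |a i - b i| := by
  classical
  induction t using Finset.induction_on with
  | empty => simp
  | insert i t hi ih =>
    rw [Finset.prod_insert hi, Finset.prod_insert hi, Finset.sum_insert hi]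
    have h1 := ih (fun j hj => ha j (Finset.mem_insert_of_mem hj))
      (fun j hj => hb j (Finset.mem_insert_of_mem hj))
    have h2 : |∏ j ∈ t, a j| ≤ 1 := by
      rw [Finset.abs_prod]
      exact Finset.prod_le_one (fun _ _ => abs_nonneg _)
        fun j hj => ha j (Finset.mem_insert_of_mem hj)
    calc |a i * ∏ j ∈ t, a j - b i * ∏ j ∈ t, b j|
        = |(a i - b i) * ∏ j ∈ t, a j + b i * (∏ j ∈ t, a j - ∏ j ∈ t, b j)| := by
          congr 1; ring
      _ ≤ |a i - b i| * |∏ j ∈ t, a j| + |b i| * |∏ j ∈ t, a j - ∏ j ∈ t, b j| := by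
          rw [← abs_mul, ← abs_mul]
          exact abs_add_le _ _
      _ ≤ |a i - b i| * 1 + 1 * ∑ j ∈ t, |a j - b j| := by
          gcongr
          exact hb i (Finset.mem_insert_self _ _)
      _ = _ := by ring

end UltrafilterSpace

section ProductModel

variable {V : Type} [Fintype V] [DecidableEq V]

/-- The point with the coordinates of `x` in `I` and those of `z` outside `I`. -/
def glue {X : V → Type} (I : Finset V) (x z : ∀ i, X i) : ∀ i, X i :=
  fun i => if i ∈ I then x i else z i

theorem glue_glue {X : V → Type} (I : Finset V) (x z : ∀ i, X i) :
    glue I (glue I x z) (glue I z x) = x := by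
  ext i
  by_cases hi : i ∈ I <;> simp [glue, hi]

theorem prod_glue_mul {X : V → Type} (w : ∀ i, X i → ℝ) (I : Finset V) (x z : ∀ i, X i) :
    (∏ i, w i (glue I x z i)) * ∏ i, w i (glue I z x i) =
      (∏ i, w i (x i)) * ∏ i, w i (z i) := by
  rw [← Finset.prod_mul_distrib, ← Finset.prod_mul_distrib]
  refine Finset.prod_congr rfl fun i _ => ?_
  by_cases hi : i ∈ I <;> simp [glue, hi, mul_comm]

theorem sum_prod_weight {X : V → Type} [∀ i, Fintype (X i)] {w : ∀ i, X i → ℝ}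
    (hw1 : ∀ i, ∑ x, w i x = 1) : ∑ x : ∀ i, X i, ∏ i, w i (x i) = 1 := by
  rw [← Fintype.prod_sum]
  simp [hw1]

/-- Averaging over the coordinates outside `I` separately does not change an expectation. -/
theorem sum_sum_glue {X : V → Type} [∀ i, Fintype (X i)] {w : ∀ i, X i → ℝ}
    (hw1 : ∀ i, ∑ x, w i x = 1) (I : Finset V) (F : (∀ i, X i) → ℝ) :
    ∑ z : ∀ i, X i, (∏ i, w i (z i)) * ∑ x : ∀ i, X i, (∏ i, w i (x i)) * F (glue I x z) =
      ∑ x : ∀ i, X i, (∏ i, w i (x i)) * F x := by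
  let e : ((∀ i, X i) × (∀ i, X i)) ≃ ((∀ i, X i) × (∀ i, X i)) :=
    { toFun := fun p => (glue I p.1 p.2, glue I p.2 p.1)
      invFun := fun p => (glue I p.1 p.2, glue I p.2 p.1)
      left_inv := fun p => by simp [glue_glue]
      right_inv := fun p => by simp [glue_glue] }
  have h1 := e.sum_comp fun p => ((∏ i, w i (p.1 i)) * ∏ i, w i (p.2 i)) * F p.1
  rw [Fintype.sum_prod_type, Fintype.sum_prod_type] at h1
  simp only [e, Equiv.coe_fn_mk, prod_glue_mul] at h1
  calc _ = ∑ x : ∀ i, X i, ∑ z : ∀ i, X i,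
        (∏ i, w i (x i)) * (∏ i, w i (z i)) * F (glue I x z) := by
        rw [Finset.sum_comm]
        refine Finset.sum_congr rfl fun z _ => ?_
        rw [Finset.mul_sum]
        exact Finset.sum_congr rfl fun x _ => by ring
    _ = _ := by
        rw [h1]
        refine Finset.sum_congr rfl fun x _ => ?_
        rw [← Finset.sum_mul, ← Finset.mul_sum, sum_prod_weight hw1, mul_one]

theorem exists_abs_sum_le_glue {X : V → Type} [∀ i, Fintype (X i)] {w : ∀ i, X i → ℝ}
    (hw : ∀ i x, 0 ≤ w i x) (hw1 : ∀ i, ∑ x, w i x = 1) (I : Finset V) (F : (∀ i, X i) → ℝ) :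
    ∃ z : ∀ i, X i, |∑ x : ∀ i, X i, (∏ i, w i (x i)) * F x| ≤
      |∑ x : ∀ i, X i, (∏ i, w i (x i)) * F (glue I x z)| := by
  have hne : (Finset.univ : Finset (∀ i, X i)).Nonempty := by
    by_contra hc
    have := sum_prod_weight hw1
    rw [Finset.not_nonempty_iff_eq_empty.1 hc] at this
    simp at this
  obtain ⟨z, -, hz⟩ := Finset.exists_max_image Finset.univ
    (fun z => |∑ x : ∀ i, X i, (∏ i, w i (x i)) * F (glue I x z)|) hne
  refine ⟨z, ?_⟩
  have hnn : ∀ x : ∀ i, X i, 0 ≤ ∏ i, w i (x i) := fun x =>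
    Finset.prod_nonneg fun i _ => hw i _
  rw [← sum_sum_glue hw1 I F]
  refine (Finset.abs_sum_le_sum_abs _ _).trans ?_
  calc _ ≤ ∑ y : ∀ i, X i, (∏ i, w i (y i)) *
        |∑ x : ∀ i, X i, (∏ i, w i (x i)) * F (glue I x z)| := by
        refine Finset.sum_le_sum fun y hy => ?_
        rw [abs_mul, abs_of_nonneg (hnn y)]
        exact mul_le_mul_of_nonneg_left (hz y hy) (hnn y)
    _ = _ := by rw [← Finset.sum_mul, sum_prod_weight hw1, one_mul]

end ProductModel

theorem integrable_of_abs_le_one {Ω : Type*} {m0 : MeasurableSpace Ω} {μ : Measure Ω}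
    [IsFiniteMeasure μ] {F : Ω → ℝ} (hF : Measurable F) (h1 : ∀ ω, |F ω| ≤ 1) : Integrable F μ :=
  Integrable.of_bound hF.aestronglyMeasurable 1 (ae_of_all _ h1)

section CondProbDefect

variable {Ω : Type*} {n : MeasurableSpace Ω} {m0 : MeasurableSpace Ω} {μ : Measure Ω} {B : Set Ω}

theorem abs_condProb_sub_indicator_le (μ : Measure Ω) (n : MeasurableSpace Ω) (B : Set Ω) (ω : Ω) :
    |condProb μ n B ω - B.indicator (1 : Ω → ℝ) ω| ≤ 1 := by
  have h1 := condProb_nonneg μ n B ω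
  have h2 := indicator_one_le_one B ω
  have h3 := condProb_le_one μ n B ω
  have h4 := indicator_one_nonneg B ω
  rw [abs_le]
  constructor <;> linarith

variable [IsFiniteMeasure μ]

theorem integrable_condProb (hn : n ≤ m0) : Integrable (condProb μ n B) μ :=
  integrable_of_unit ((measurable_condProb μ n B).mono hn le_rfl) (condProb_nonneg _ _ _)
    (condProb_le_one _ _ _)

theorem integral_condProb_sub_indicator_mul_eq_zero (hn : n ≤ m0) (hB : MeasurableSet B)
    {H : Ω → ℝ} (hH : Measurable[n] H) (h1 : ∀ ω, |H ω| ≤ 1) :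
    ∫ ω, (condProb μ n B ω - B.indicator (1 : Ω → ℝ) ω) * H ω ∂μ = 0 := by
  have hcm : Measurable (condProb μ n B) := (measurable_condProb μ n B).mono hn le_rfl
  have hgm : Measurable fun ω => condProb μ n B ω - B.indicator (1 : Ω → ℝ) ω :=
    hcm.sub (measurable_indicator_one hB)
  have hunit : ∀ H : Ω → ℝ, Measurable[n] H → (∀ ω, 0 ≤ H ω) → (∀ ω, H ω ≤ 1) →
      ∫ ω, (condProb μ n B ω - B.indicator (1 : Ω → ℝ) ω) * H ω ∂μ = 0 := by
    intro H hH h0 h1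
    have e := integral_mul_eq_setIntegral_of_forall hn hB (integrable_condProb (μ := μ) (B := B) hn)
      (fun S hS => setIntegral_condProb hn hB hS) hH h0 h1
    have hHm : Measurable H := hH.mono hn le_rfl
    have i1 : Integrable (fun u => H u * condProb μ n B u) μ :=
      integrable_of_unit (hHm.mul hcm) (fun u => mul_nonneg (h0 u) (condProb_nonneg _ _ _ _))
        fun u => mul_le_one₀ (h1 u) (condProb_nonneg _ _ _ _) (condProb_le_one _ _ _ _)
    have i2 : Integrable (fun u => H u * B.indicator (1 : Ω → ℝ) u) μ :=
      integrable_of_unit (hHm.mul (measurable_indicator_one hB))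
        (fun u => mul_nonneg (h0 u) (indicator_one_nonneg _ _))
        fun u => mul_le_one₀ (h1 u) (indicator_one_nonneg _ _) (indicator_one_le_one _ _)
    calc _ = ∫ u, (H u * condProb μ n B u - H u * B.indicator (1 : Ω → ℝ) u) ∂μ := by
          congr 1; ext u; ring
      _ = 0 := by rw [integral_sub i1 i2, e]; exact sub_self _
  have e1 := hunit (fun u => (H u + 1) / 2) ((hH.add_const 1).div_const 2)
    (fun u => by have := abs_le.1 (h1 u); linarith)
    (fun u => by have := abs_le.1 (h1 u); linarith)
  have e2 := hunit (fun _ => 1 / 2) measurable_const (fun u => by norm_num)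
    (fun u => by norm_num)
  have hHm : Measurable H := hH.mono hn le_rfl
  have i1 : Integrable
      (fun u => (condProb μ n B u - B.indicator (1 : Ω → ℝ) u) * ((H u + 1) / 2)) μ :=
    integrable_of_abs_le_one (hgm.mul ((hHm.add_const 1).div_const 2)) fun u => by
      rw [abs_mul]
      refine mul_le_one₀ (abs_condProb_sub_indicator_le _ _ _ _) (abs_nonneg _) (abs_le.2 ?_)
      have := abs_le.1 (h1 u)
      constructor <;> linarith
  have i2 : Integrable (fun u => (condProb μ n B u - B.indicator (1 : Ω → ℝ) u) * (1 / 2)) μ :=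
    (integrable_of_abs_le_one hgm (abs_condProb_sub_indicator_le _ _ _)).mul_const _
  calc _ = ∫ u, 2 * ((condProb μ n B u - B.indicator (1 : Ω → ℝ) u) * ((H u + 1) / 2) -
        (condProb μ n B u - B.indicator (1 : Ω → ℝ) u) * (1 / 2)) ∂μ := by
        congr 1; ext u; ring
    _ = 0 := by rw [integral_const_mul, integral_sub i1 i2, e1, e2]; norm_num

end CondProbDefect

section SectionSystem

variable {V : Type} [DecidableEq V] (X : ℕ → V → Type)

/-- Restriction of a point of one of the product spaces to the coordinates in `I`. -/
def secProj (I : Finset V) (y : Σ n, ∀ i, X n i) : Σ n, ∀ i : I, X n i := ⟨y.1, fun i => y.2 i⟩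

/-- The σ-algebra of the events depending on the coordinates in `I`. -/
def secAlgebra (I : Finset V) : MeasurableSpace (Ultrafilter (Σ n, ∀ i, X n i)) :=
  MeasurableSpace.comap (Ultrafilter.map (secProj X I)) inferInstance

variable {X}

/-- The continuous function on the limit space given by a function of the coordinates in `I`. -/
noncomputable def secExtend {I : Finset V} (h : (Σ n, ∀ i : I, X n i) → Icc (-1 : ℝ) 1)
    (u : Ultrafilter (Σ n, ∀ i, X n i)) : ℝ :=
  unitExtend h (u.map (secProj X I))

theorem continuous_secExtend {I : Finset V} (h : (Σ n, ∀ i : I, X n i) → Icc (-1 : ℝ) 1) :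
    Continuous (secExtend h) :=
  (continuous_unitExtend h).comp (Ultrafilter.continuous_map _)

theorem secExtend_pure {I : Finset V} (h : (Σ n, ∀ i : I, X n i) → Icc (-1 : ℝ) 1)
    (y : Σ n, ∀ i, X n i) : secExtend h (pure y) = h (secProj X I y) := by
  rw [secExtend, Ultrafilter.map_pure, unitExtend_pure]

theorem abs_secExtend_le {I : Finset V} (h : (Σ n, ∀ i : I, X n i) → Icc (-1 : ℝ) 1)
    (u : Ultrafilter (Σ n, ∀ i, X n i)) : |secExtend h u| ≤ 1 := abs_unitExtend_le _ _

theorem measurable_secExtend {I : Finset V} (h : (Σ n, ∀ i : I, X n i) → Icc (-1 : ℝ) 1) :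
    Measurable[secAlgebra X I] (secExtend h) :=
  (measurable_unitExtend h).comp (comap_measurable _)

theorem secAlgebra_le (I : Finset V) : secAlgebra X I ≤ Ultrafilter.instMeasurableSpaceBorel :=
  (Ultrafilter.continuous_map (secProj X I)).measurable.comap_le

theorem secAlgebra_mono : Monotone (secAlgebra X) := by
  intro I J hIJ
  let ρ : (Σ n, ∀ i : J, X n i) → Σ n, ∀ i : I, X n i := fun y => ⟨y.1, fun i => y.2 ⟨i, hIJ i.2⟩⟩
  have e : Ultrafilter.map (secProj X I) = Ultrafilter.map ρ ∘ Ultrafilter.map (secProj X J) := by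
    ext1 u
    exact (Ultrafilter.map_map u (m := secProj X J) (n := ρ)).symm
  rw [secAlgebra, e, ← MeasurableSpace.comap_comp]
  exact MeasurableSpace.comap_mono (Ultrafilter.continuous_map ρ).measurable.comap_le

theorem abs_prod_le_one {ι : Type*} (t : Finset ι) {a : ι → ℝ} (ha : ∀ i ∈ t, |a i| ≤ 1) :
    |∏ i ∈ t, a i| ≤ 1 := by
  rw [Finset.abs_prod]
  exact Finset.prod_le_one (fun _ _ => abs_nonneg _) ha

variable [Fintype V] [∀ n i, Fintype (X n i)] {w : ∀ n i, X n i → ℝ}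
  {ν : Measure (Ultrafilter (Σ n, ∀ i, X n i))}

/-- `ν` is a limit of the product measures with weights `w`. -/
def IsProductLimit (w : ∀ n i, X n i → ℝ) (ν : Measure (Ultrafilter (Σ n, ∀ i, X n i))) : Prop :=
  ∀ G : Ultrafilter (Σ n, ∀ i, X n i) → ℝ, Continuous G →
    Tendsto (fun n => ∑ x : ∀ i, X n i, (∏ i, w n i (x i)) * G (pure ⟨n, x⟩))
      (hyperfilter ℕ) (𝓝 (∫ u, G u ∂ν))

theorem IsProductLimit.exists_abs_integral_secExtend_le (hν : IsProductLimit w ν)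
    (hw : ∀ n i x, 0 ≤ w n i x) (hw1 : ∀ n i, ∑ x, w n i x = 1) {I : Finset V}
    (g : (Σ n, ∀ i : I, X n i) → Icc (-1 : ℝ) 1) (t : Finset (Finset V))
    (h : ∀ J : Finset V, (Σ n, ∀ i : J, X n i) → Icc (-1 : ℝ) 1) :
    ∃ h' : ∀ J : Finset V, (Σ n, ∀ i : ↥(J ∩ I), X n i) → Icc (-1 : ℝ) 1,
      |∫ u, secExtend g u * ∏ J ∈ t, secExtend (h J) u ∂ν| ≤
        |∫ u, secExtend g u * ∏ J ∈ t, secExtend (h' J) u ∂ν| := by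
  choose z hz using fun n => exists_abs_sum_le_glue (hw n) (hw1 n) I fun x =>
    (g (secProj X I ⟨n, x⟩) : ℝ) * ∏ J ∈ t, (h J (secProj X J ⟨n, x⟩) : ℝ)
  let h' : ∀ J : Finset V, (Σ n, ∀ i : ↥(J ∩ I), X n i) → Icc (-1 : ℝ) 1 := fun J y =>
    h J ⟨y.1, fun i => if hi : (i : V) ∈ J ∩ I then y.2 ⟨i, hi⟩ else z y.1 i⟩
  refine ⟨h', ?_⟩
  have hc : ∀ (K : Finset V → Finset V)
      (f : ∀ J : Finset V, (Σ n, ∀ i : K J, X n i) → Icc (-1 : ℝ) 1),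
      Continuous fun u => secExtend g u * ∏ J ∈ t, secExtend (f J) u := fun K f =>
    (continuous_secExtend g).mul (continuous_finsetProd _ fun J _ => continuous_secExtend (f J))
  refine le_of_tendsto_of_tendsto' (hν _ (hc _ h)).abs (hν _ (hc _ h')).abs fun n => ?_
  simp only [secExtend_pure]
  refine (hz n).trans (le_of_eq ?_)
  congr 1
  refine Finset.sum_congr rfl fun x _ => ?_
  congr 2
  · congr 2
    simp only [secProj, Sigma.mk.injEq, heq_eq_eq, true_and]
    ext i
    simp [glue]
  · refine Finset.prod_congr rfl fun J _ => ?_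
    congr 2
    simp only [secProj, Sigma.mk.injEq, heq_eq_eq, true_and]
    ext i
    simp [glue]

variable [IsProbabilityMeasure ν] [ν.Regular]

/-- A function of the coordinates in `I` which is orthogonal to the functions of the coordinates
in the sets `J ∩ I` is orthogonal to products of functions of the coordinates in the sets `J`. -/
theorem IsProductLimit.integral_mul_prod_eq_zero (hν : IsProductLimit w ν)
    (hw : ∀ n i x, 0 ≤ w n i x) (hw1 : ∀ n i, ∑ x, w n i x = 1) {I : Finset V}
    {g : Ultrafilter (Σ n, ∀ i, X n i) → ℝ} (hg : Measurable[secAlgebra X I] g)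
    (hg1 : ∀ u, |g u| ≤ 1) (t : Finset (Finset V))
    (horth : ∀ H, Measurable[⨆ J ∈ t, secAlgebra X (J ∩ I)] H → (∀ u, |H u| ≤ 1) →
      ∫ u, g u * H u ∂ν = 0)
    {φ : Finset V → Ultrafilter (Σ n, ∀ i, X n i) → ℝ}
    (hφ : ∀ J ∈ t, Measurable[secAlgebra X J] (φ J)) (hφ1 : ∀ J ∈ t, ∀ u, |φ J u| ≤ 1) :
    ∫ u, g u * ∏ J ∈ t, φ J u ∂ν = 0 := by
  have hbound : ∀ η : ℝ, 0 < η → |∫ u, g u * ∏ J ∈ t, φ J u ∂ν| ≤ (t.card + 2) * η := by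
    intro η hη
    obtain ⟨g', hg'⟩ := exists_unitExtend_approx (ν := ν) (secProj X I) hg hg1 hη
    have hex : ∀ J : Finset V, ∃ h : (Σ n, ∀ i : J, X n i) → Icc (-1 : ℝ) 1,
        J ∈ t → ∫ u, |φ J u - secExtend h u| ∂ν ≤ η := by
      intro J
      by_cases hJ : J ∈ t
      · obtain ⟨h, hh⟩ := exists_unitExtend_approx (ν := ν) (secProj X J) (hφ J hJ) (hφ1 J hJ) hη
        exact ⟨h, fun _ => hh⟩
      · exact ⟨fun _ => ⟨0, by norm_num⟩, fun hJ' => absurd hJ' hJ⟩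
    choose h hh using hex
    obtain ⟨h', hh'⟩ := hν.exists_abs_integral_secExtend_le hw hw1 g' t h
    have hgm : Measurable g := hg.mono (secAlgebra_le I) le_rfl
    have hφm : ∀ J ∈ t, Measurable (φ J) := fun J hJ => (hφ J hJ).mono (secAlgebra_le J) le_rfl
    have hg'm : Measurable (secExtend g') := (continuous_secExtend g').measurable
    have hhm : ∀ J, Measurable (secExtend (h J)) := fun J => (continuous_secExtend (h J)).measurable
    have hh'm : ∀ J, Measurable (secExtend (h' J)) := fun J =>
      (continuous_secExtend (h' J)).measurable
    have habs : ∀ {a b : ℝ}, |a| ≤ 1 → |b| ≤ 1 → |a * b| ≤ 1 := fun ha hb => by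
      rw [abs_mul]; exact mul_le_one₀ ha (abs_nonneg _) hb
    have hi1 : Integrable (fun u => g u * ∏ J ∈ t, φ J u) ν :=
      integrable_of_abs_le_one (hgm.mul (Finset.measurable_prod _ hφm))
        fun u => habs (hg1 u) (abs_prod_le_one t fun J hJ => hφ1 J hJ u)
    have hi2 : Integrable (fun u => secExtend g' u * ∏ J ∈ t, secExtend (h J) u) ν :=
      integrable_of_abs_le_one (hg'm.mul (Finset.measurable_prod _ fun J _ => hhm J))
        fun u => habs (abs_secExtend_le _ u) (abs_prod_le_one t fun J hJ => abs_secExtend_le _ u)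
    have hi3 : Integrable (fun u => secExtend g' u * ∏ J ∈ t, secExtend (h' J) u) ν :=
      integrable_of_abs_le_one (hg'm.mul (Finset.measurable_prod _ fun J _ => hh'm J))
        fun u => habs (abs_secExtend_le _ u) (abs_prod_le_one t fun J hJ => abs_secExtend_le _ u)
    have hi4 : Integrable (fun u => g u * ∏ J ∈ t, secExtend (h' J) u) ν :=
      integrable_of_abs_le_one (hgm.mul (Finset.measurable_prod _ fun J _ => hh'm J))
        fun u => habs (hg1 u) (abs_prod_le_one t fun J hJ => abs_secExtend_le _ u)
    have hd : Integrable (fun u => |g u - secExtend g' u|) ν :=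
      ((integrable_of_abs_le_one hgm hg1).sub
        (integrable_of_abs_le_one hg'm (abs_secExtend_le _))).norm
    have hdJ : ∀ J ∈ t, Integrable (fun u => |φ J u - secExtend (h J) u|) ν := fun J hJ =>
      ((integrable_of_abs_le_one (hφm J hJ) (hφ1 J hJ)).sub
        (integrable_of_abs_le_one (hhm J) (abs_secExtend_le _))).norm
    have e1 : |∫ u, g u * ∏ J ∈ t, φ J u ∂ν -
        ∫ u, secExtend g' u * ∏ J ∈ t, secExtend (h J) u ∂ν| ≤ η + t.card * η := by
      rw [← integral_sub hi1 hi2]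
      refine (abs_integral_le_integral_abs).trans ?_
      calc _ ≤ ∫ u, (|g u - secExtend g' u| + ∑ J ∈ t, |φ J u - secExtend (h J) u|) ∂ν := by
            refine integral_mono (hi1.sub hi2).abs
              (hd.add (integrable_finsetSum _ hdJ)) fun u => ?_
            have h1 := abs_prod_sub_prod_le t (fun J hJ => hφ1 J hJ u)
              (fun J _ => abs_secExtend_le (h J) u)
            have h2 := abs_prod_le_one t (fun J hJ => hφ1 J hJ u)
            calc |g u * ∏ J ∈ t, φ J u - secExtend g' u * ∏ J ∈ t, secExtend (h J) u|
                = |(g u - secExtend g' u) * ∏ J ∈ t, φ J u +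
                  secExtend g' u * (∏ J ∈ t, φ J u - ∏ J ∈ t, secExtend (h J) u)| := by
                  congr 1; ring
              _ ≤ |g u - secExtend g' u| * |∏ J ∈ t, φ J u| +
                  |secExtend g' u| * |∏ J ∈ t, φ J u - ∏ J ∈ t, secExtend (h J) u| := by
                  rw [← abs_mul, ← abs_mul]
                  exact abs_add_le _ _
              _ ≤ |g u - secExtend g' u| * 1 + 1 * ∑ J ∈ t, |φ J u - secExtend (h J) u| := by
                  gcongr
                  exact abs_secExtend_le _ _
              _ = _ := by ring
        _ = ∫ u, |g u - secExtend g' u| ∂ν + ∑ J ∈ t, ∫ u, |φ J u - secExtend (h J) u| ∂ν := by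
            rw [integral_add hd (integrable_finsetSum _ hdJ), integral_finsetSum _ hdJ]
        _ ≤ η + ∑ _J ∈ t, η := add_le_add hg' (Finset.sum_le_sum fun J hJ => hh J hJ)
        _ = _ := by simp
    have e2 : |∫ u, secExtend g' u * ∏ J ∈ t, secExtend (h' J) u ∂ν -
        ∫ u, g u * ∏ J ∈ t, secExtend (h' J) u ∂ν| ≤ η := by
      rw [← integral_sub hi3 hi4]
      refine (abs_integral_le_integral_abs).trans (le_trans ?_ hg')
      refine integral_mono (hi3.sub hi4).abs hd fun u => ?_
      have h2 := abs_prod_le_one t (fun J _ => abs_secExtend_le (h' J) u)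
      calc |secExtend g' u * ∏ J ∈ t, secExtend (h' J) u - g u * ∏ J ∈ t, secExtend (h' J) u|
          = |g u - secExtend g' u| * |∏ J ∈ t, secExtend (h' J) u| := by
            rw [← abs_mul, ← abs_neg]; congr 1; ring
        _ ≤ |g u - secExtend g' u| * 1 := by gcongr
        _ = _ := mul_one _
    rw [horth (fun u => ∏ J ∈ t, secExtend (h' J) u) (Finset.measurable_prod _ fun J hJ =>
      (measurable_secExtend (h' J)).mono (le_iSup₂ (f := fun (J : Finset V) (_ : J ∈ t) =>
        secAlgebra X (J ∩ I)) J hJ) le_rfl)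
      fun u => abs_prod_le_one t fun J _ => abs_secExtend_le _ u, sub_zero] at e2
    have e3 := abs_sub_abs_le_abs_sub (∫ u, g u * ∏ J ∈ t, φ J u ∂ν)
      (∫ u, secExtend g' u * ∏ J ∈ t, secExtend (h J) u ∂ν)
    linarith
  rw [← abs_nonpos_iff]
  refine le_of_forall_pos_le_add fun ε hε => ?_
  have := hbound (ε / (t.card + 2)) (by positivity)
  rw [mul_div_cancel₀ _ (by positivity)] at this
  linarith

theorem IsProductLimit.condIndepSystem (hν : IsProductLimit w ν)
    (hw : ∀ n i x, 0 ≤ w n i x) (hw1 : ∀ n i, ∑ x, w n i x = 1) :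
    CondIndepSystem ν (secAlgebra X) where
  le := secAlgebra_le
  mono := secAlgebra_mono
  setIntegral_eq I F B S hB hS := by
    have hnI : ⨆ J ∈ F, secAlgebra X (J ∩ I) ≤ secAlgebra X I :=
      iSup₂_le fun J _ => secAlgebra_mono Finset.inter_subset_right
    have hn0 := hnI.trans (secAlgebra_le I)
    have hB0 := secAlgebra_le I _ hB
    have hBi : Integrable (B.indicator (1 : Ultrafilter (Σ n, ∀ i, X n i) → ℝ)) ν :=
      (integrable_const (1 : ℝ)).indicator hB0
    have hci : Integrable (condProb ν (⨆ J ∈ F, secAlgebra X (J ∩ I)) B) ν :=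
      integrable_condProb hn0
    have hg : Measurable[secAlgebra X I] fun u =>
        condProb ν (⨆ J ∈ F, secAlgebra X (J ∩ I)) B u -
          B.indicator (1 : Ultrafilter (Σ n, ∀ i, X n i) → ℝ) u :=
      ((measurable_condProb ν _ B).mono hnI le_rfl).sub (measurable_indicator_one hB)
    have horth := fun (H : Ultrafilter (Σ n, ∀ i, X n i) → ℝ)
        (hH : Measurable[⨆ J ∈ F, secAlgebra X (J ∩ I)] H) (h1 : ∀ u, |H u| ≤ 1) =>
      integral_condProb_sub_indicator_mul_eq_zero (μ := ν) hn0 hB0 hH h1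
    have hg1 := abs_condProb_sub_indicator_le ν (⨆ J ∈ F, secAlgebra X (J ∩ I)) B
    have hgi : Integrable (fun u => condProb ν (⨆ J ∈ F, secAlgebra X (J ∩ I)) B u -
        B.indicator (1 : Ultrafilter (Σ n, ∀ i, X n i) → ℝ) u) ν := hci.sub hBi
    have hgint := horth (fun _ => 1) measurable_const (fun _ => by norm_num)
    simp only [mul_one] at hgint
    have hF0 : ⨆ J ∈ F, secAlgebra X J ≤ Ultrafilter.instMeasurableSpaceBorel :=
      iSup₂_le fun J _ => secAlgebra_le J
    have key : ∀ S, MeasurableSet[⨆ J ∈ F, secAlgebra X J] S →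
        ∫ u in S, (condProb ν (⨆ J ∈ F, secAlgebra X (J ∩ I)) B u -
          B.indicator (1 : Ultrafilter (Σ n, ∀ i, X n i) → ℝ) u) ∂ν = 0 := by
      intro S hS
      refine MeasurableSpace.induction_on_inter (m := ⨆ J ∈ F, secAlgebra X J)
        (C := fun S _ => ∫ u in S, (condProb ν (⨆ J ∈ F, secAlgebra X (J ∩ I)) B u -
          B.indicator (1 : Ultrafilter (Σ n, ∀ i, X n i) → ℝ) u) ∂ν = 0)
        (generateFrom_piiUnionInter_measurableSet (secAlgebra X) F).symm
        (isPiSystem_piiUnionInter _ (fun J => @MeasurableSpace.isPiSystem_measurableSet _ (_)) F)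
        (by simp) ?_ ?_ ?_ S hS
      · rintro T ⟨t, ht, f, hf, rfl⟩
        have hT0 : MeasurableSet (⋂ J ∈ t, f J) :=
          Finset.measurableSet_biInter _ fun J hJ => secAlgebra_le J _ (hf J hJ)
        have e := hν.integral_mul_prod_eq_zero hw hw1 hg hg1 t
          (fun H hH => horth H (hH.mono (biSup_mono fun J hJ => ht hJ) le_rfl))
          (φ := fun J => (f J).indicator 1) (fun J hJ => measurable_indicator_one (hf J hJ))
          (fun J _ u => abs_le.2 ⟨by linarith [indicator_one_nonneg (f J) u],
            indicator_one_le_one _ _⟩)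
        rw [← integral_indicator hT0, ← e]
        refine integral_congr_ae (ae_of_all _ fun u => ?_)
        simp only [prod_indicator_one]
        by_cases hu : u ∈ ⋂ J ∈ t, f J
        · rw [indicator_of_mem hu, indicator_of_mem hu, Pi.one_apply, mul_one]
        · rw [indicator_of_notMem hu, indicator_of_notMem hu, mul_zero]
      · intro T hT e
        have := integral_add_compl (hF0 _ hT) hgi
        linarith
      · intro f hd hf e
        rw [integral_iUnion (fun i => hF0 _ (hf i)) hd hgi.integrableOn]
        simp [e]
    have e := key S hS
    rw [integral_sub hci.integrableOn hBi.integrableOn, setIntegral_indicator_one hB0] at e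
    linarith

end SectionSystem

section Transfer

variable {V : Type} [DecidableEq V] {X : ℕ → V → Type}
  [Fintype V] [∀ n i, Fintype (X n i)] {w : ∀ n i, X n i → ℝ}
  {ν : Measure (Ultrafilter (Σ n, ∀ i, X n i))} [IsProbabilityMeasure ν]

theorem Ultrafilter.isClopen_setOf_mem {α : Type*} (T : Set α) :
    IsClopen {u : Ultrafilter α | T ∈ u} :=
  ⟨ultrafilter_isClosed_basic T, ultrafilter_isOpen_basic T⟩

theorem IsProductLimit.tendsto_measureReal (hν : IsProductLimit w ν)
    (T : Set (Σ n, ∀ i, X n i)) :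
    Tendsto (fun n => ∑ x : ∀ i, X n i, (∏ i, w n i (x i)) *
      T.indicator (1 : (Σ n, ∀ i, X n i) → ℝ) ⟨n, x⟩) (hyperfilter ℕ) (𝓝 (ν.real {u | T ∈ u})) := by
  have hc := Ultrafilter.isClopen_setOf_mem T
  have h := hν _ (LocallyConstant.charFn ℝ hc).continuous
  rw [LocallyConstant.coe_charFn, integral_indicator_one hc.isOpen.measurableSet] at h
  refine h.congr fun n => Finset.sum_congr rfl fun x _ => ?_
  congr 1

/-- An event of small measure depending on the coordinates in `I` is contained in an open such
event of small measure. -/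
theorem exists_isOpen_secProj_preimage [ν.Regular] {I : Finset V}
    {Z : Set (Ultrafilter (Σ n, ∀ i, X n i))} (hZ : MeasurableSet[secAlgebra X I] Z) {η : ℝ}
    (hη : ν.real Z < η) :
    ∃ O : Set (Ultrafilter (Σ n, ∀ i : I, X n i)), IsOpen O ∧
      Z ⊆ Ultrafilter.map (secProj X I) ⁻¹' O ∧
      ν.real (Ultrafilter.map (secProj X I) ⁻¹' O) < η := by
  obtain ⟨W, hW, rfl⟩ := hZ
  have hc := Ultrafilter.continuous_map (secProj X I)
  have : (ν.map (Ultrafilter.map (secProj X I))).InnerRegularCompactLTTop :=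
    Measure.InnerRegularCompactLTTop.map_of_continuous hc
  have hlt : ν.map (Ultrafilter.map (secProj X I)) W < ENNReal.ofReal η := by
    rw [Measure.map_apply hc.measurable hW]
    exact (ENNReal.lt_ofReal_iff_toReal_lt (measure_ne_top _ _)).2 hη
  obtain ⟨O, hWO, hO, hOη⟩ := W.exists_isOpen_lt_of_lt _ hlt
  refine ⟨O, hO, preimage_mono hWO, ?_⟩
  rw [Measure.map_apply hc.measurable hO.measurableSet] at hOη
  exact (ENNReal.lt_ofReal_iff_toReal_lt (measure_ne_top _ _)).1 hOη

theorem exists_removal_of_tendsto_zero {V : Type} [DecidableEq V] [Fintype V] {X : ℕ → V → Type}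
    [∀ n i, Fintype (X n i)] {w : ∀ n i, X n i → ℝ} (hw : ∀ n i x, 0 ≤ w n i x)
    (hw1 : ∀ n i, ∑ x, w n i x = 1)
    (S : ∀ i : V, Set (Σ n, ∀ j : ↥(Finset.univ.erase i), X n j))
    (hS : Tendsto (fun n => ∑ x : ∀ i, X n i, (∏ i, w n i (x i)) *
      (⋂ i, secProj X _ ⁻¹' S i).indicator (1 : (Σ n, ∀ i, X n i) → ℝ) ⟨n, x⟩) atTop (𝓝 0))
    {ε : ℝ} (hε : 0 < ε) :
    ∃ B : ∀ i : V, Set (Σ n, ∀ j : ↥(Finset.univ.erase i), X n j),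
      (∀ y, ∃ i, secProj X _ y ∈ B i) ∧
      ∃ n, ∀ i, ∑ x : ∀ i, X n i, (∏ i, w n i (x i)) *
        (secProj X _ ⁻¹' (S i ∩ B i)).indicator (1 : (Σ n, ∀ i, X n i) → ℝ) ⟨n, x⟩ ≤ ε := by
  obtain ⟨ν, hprob, hreg, hν⟩ := exists_regular_limit (α := Σ n, ∀ i, X n i)
    (fun n (x : ∀ i, X n i) => ∏ i, w n i (x i)) (fun n x => Finset.prod_nonneg fun i _ => hw n i _)
    (fun n => sum_prod_weight (hw1 n)) (fun n x => ⟨n, x⟩)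
  replace hν : IsProductLimit w ν := hν
  have hE : ∀ i : V, MeasurableSet[secAlgebra X (Finset.univ.erase i)]
      {u : Ultrafilter (Σ n, ∀ i, X n i) | secProj X (Finset.univ.erase i) ⁻¹' S i ∈ u} := fun i =>
    ⟨{u | S i ∈ u}, (ultrafilter_isOpen_basic _).measurableSet, rfl⟩
  have hE0 : ν.real (⋂ i : V, {u : Ultrafilter (Σ n, ∀ i, X n i) |
      secProj X (Finset.univ.erase i) ⁻¹' S i ∈ u}) = 0 := by
    have h := tendsto_nhds_unique (hν.tendsto_measureReal _)
      (hS.mono_left Nat.hyperfilter_le_atTop)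
    rw [← h]
    congr 1
    ext u
    simp only [mem_iInter, Set.mem_ofPred_eq]
    exact (Filter.iInter_mem (f := (u : Filter (Σ n, ∀ i, X n i)))).symm
  obtain ⟨Z, hZ, hZε, hEZ⟩ := (hν.condIndepSystem hw hw1).exists_removal_of_measureReal_eq_zero
    hE hE0 (half_pos hε)
  choose O hO hZO hOε using fun i =>
    exists_isOpen_secProj_preimage (hZ i) ((hZε i).trans_lt (half_lt_self hε))
  have hex : ∀ u : Ultrafilter (Σ n, ∀ i, X n i),
      ∃ T : ∀ i : V, Set (Σ n, ∀ j : ↥(Finset.univ.erase i), X n j),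
        (∃ i, secProj X _ ⁻¹' T i ∈ u) ∧
        ∀ (i : V) (v : Ultrafilter (Σ n, ∀ j : ↥(Finset.univ.erase i), X n j)),
          T i ∈ v → S i ∈ v → v ∈ O i := by
    intro u
    suffices h : ∃ i : V, ∃ T : Set (Σ n, ∀ j : ↥(Finset.univ.erase i), X n j),
        secProj X _ ⁻¹' T ∈ u ∧
          ∀ v : Ultrafilter (Σ n, ∀ j : ↥(Finset.univ.erase i), X n j),
            T ∈ v → S i ∈ v → v ∈ O i by
      obtain ⟨i, T, hT, hTO⟩ := h
      refine ⟨Function.update (fun _ => ∅) i T, ⟨i, by rwa [Function.update_self]⟩, fun k v => ?_⟩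
      by_cases hk : k = i
      · subst hk
        rw [Function.update_self]
        exact hTO v
      · rw [Function.update_of_ne hk]
        exact fun h => absurd h v.empty_notMem
    obtain ⟨i, hi⟩ := hEZ u
    refine ⟨i, ?_⟩
    rcases hi with hi | hi
    · exact ⟨(S i)ᶜ, Ultrafilter.compl_mem_iff_notMem.2 hi,
        fun v h h' => absurd h' (Ultrafilter.compl_mem_iff_notMem.1 h)⟩
    · obtain ⟨_, ⟨T, rfl⟩, hT, hTO⟩ :=
        ultrafilterBasis_is_basis.exists_subset_of_mem_open
          (show u.map (secProj X _) ∈ O i from hZO i hi) (hO i)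
      exact ⟨T, hT, fun v hv _ => hTO hv⟩
  choose T hTu hTO using hex
  obtain ⟨t, ht⟩ := CompactSpace.elim_nhds_subcover
    (fun u => ⋃ i, {v : Ultrafilter (Σ n, ∀ i, X n i) | secProj X _ ⁻¹' T u i ∈ v}) fun u =>
      (isOpen_iUnion fun i => ultrafilter_isOpen_basic _).mem_nhds (mem_iUnion.2 (hTu u))
  refine ⟨fun i => ⋃ u ∈ t, T u i, fun y => ?_, ?_⟩
  · have hy : (pure y : Ultrafilter (Σ n, ∀ i, X n i)) ∈ (⊤ : Set _) := mem_univ _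
    rw [← ht] at hy
    obtain ⟨u, hu, hy⟩ := mem_iUnion₂.1 hy
    obtain ⟨i, hi⟩ := mem_iUnion.1 hy
    exact ⟨i, mem_iUnion₂.2 ⟨u, hu, hi⟩⟩
  · have hlt : ∀ i : V, ν.real {u : Ultrafilter (Σ n, ∀ i, X n i) |
        secProj X (Finset.univ.erase i) ⁻¹' (S i ∩ ⋃ u ∈ t, T u i) ∈ u} < ε := by
      intro i
      refine (measureReal_mono fun u hu => ?_).trans_lt (hOε i)
      have h1 : S i ∩ ⋃ u ∈ t, T u i ∈ u.map (secProj X (Finset.univ.erase i)) := hu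
      have h2 : ⋃ u ∈ t, T u i ∈ u.map (secProj X (Finset.univ.erase i)) :=
        mem_of_superset h1 inter_subset_right
      obtain ⟨u', -, hu'⟩ := (Ultrafilter.finite_biUnion_mem_iff t.finite_toSet).1 h2
      exact hTO u' i _ hu' (mem_of_superset h1 inter_subset_left)
    have hev := eventually_all.2 fun i => (hν.tendsto_measureReal _).eventually_lt_const (hlt i)
    obtain ⟨n, hn⟩ := hev.exists
    exact ⟨n, fun i => (hn i).le⟩

end Transfer

section FiniteRemoval

variable {V : Type} [DecidableEq V] [Fintype V]

theorem sum_restrict_ne {X : V → Type} [∀ i, Fintype (X i)] {w : ∀ i, X i → ℝ} (i : V)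
    (hw1 : ∑ x, w i x = 1) (F : (∀ j : {j // j ≠ i}, X j.1) → ℝ) :
    ∑ x : ∀ i, X i, (∏ i, w i (x i)) * F (fun j => x j.1) =
      ∑ y : ∀ j : {j // j ≠ i}, X j.1, (∏ j, w j.1 (y j)) * F y := by
  have h := (Equiv.piSplitAt i X).sum_comp fun p =>
    w i p.1 * ((∏ j, w (Subtype.val j) (p.2 j)) * F p.2)
  simp only [Equiv.piSplitAt_apply] at h
  rw [Fintype.sum_prod_type] at h
  simp only [← Finset.mul_sum] at h
  rw [← Finset.sum_mul, hw1, one_mul] at h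
  rw [← h]
  refine Finset.sum_congr rfl fun x _ => ?_
  rw [Fintype.prod_eq_mul_prod_subtype_ne _ i, mul_assoc]

theorem exists_removal_sets (V : Type) [DecidableEq V] [Fintype V] {ε : ℝ} (hε : 0 < ε) :
    ∃ δ : ℝ, 0 < δ ∧ ∀ (X : V → Type) [∀ i, Fintype (X i)] (w : ∀ i, X i → ℝ),
      (∀ i x, 0 ≤ w i x) → (∀ i, ∑ x, w i x = 1) →
      ∀ A : ∀ i : V, Set (∀ j : {j // j ≠ i}, X j.1),
      ∑ x : ∀ i, X i, (∏ i, w i (x i)) *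
        (⋂ i, {x : ∀ i, X i | (fun j : {j // j ≠ i} => x j.1) ∈ A i}).indicator 1 x ≤ δ →
      ∃ B : ∀ i : V, Set (∀ j : {j // j ≠ i}, X j.1),
        (∀ x : ∀ i, X i, ∃ i, (fun j : {j // j ≠ i} => x j.1) ∈ B i) ∧
        ∀ i, ∑ x : ∀ i, X i, (∏ i, w i (x i)) *
          {x : ∀ i, X i | (fun j : {j // j ≠ i} => x j.1) ∈ A i ∩ B i}.indicator 1 x ≤ ε := by
  by_contra hcon
  push Not at hcon
  choose X inst w hw hw1 A hA hB using fun n : ℕ => hcon (1 / ((n : ℝ) + 1)) (by positivity)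
  have hne : ∀ {i : V} (j : {j // j ≠ i}), j.1 ∈ Finset.univ.erase i := fun j =>
    Finset.mem_erase.2 ⟨j.2, Finset.mem_univ _⟩
  obtain ⟨B, hB1, n, hn⟩ := exists_removal_of_tendsto_zero hw hw1
    (fun i => {y | (fun j : {j // j ≠ i} => y.2 ⟨j.1, hne j⟩) ∈ A y.1 i}) (by
      refine squeeze_zero (fun n => Finset.sum_nonneg fun x _ => mul_nonneg
        (Finset.prod_nonneg fun i _ => hw n i _) (indicator_one_nonneg _ _)) (fun n => ?_)
        tendsto_one_div_add_atTop_nhds_zero_nat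
      refine (Finset.sum_congr rfl fun x _ => congrArg _ ?_).trans_le (hA n)
      exact indicator_eq_indicator (by simp only [mem_iInter]; rfl) rfl) hε
  obtain ⟨i, hi⟩ := hB n
    (fun i => {y | (⟨n, fun j => y ⟨j.1, Finset.ne_of_mem_erase j.2⟩⟩ :
      Σ n, ∀ j : ↥(Finset.univ.erase i), X n j) ∈ B i}) (fun x => hB1 ⟨n, x⟩)
  exact absurd (hn i) (not_le.2 hi)

end FiniteRemoval

/-- Hypergraph removal lemma, functional form, for finite (discrete) probability spaces. -/
theorem hypergraph_removal (d : ℕ) (hd : 1 ≤ d) (ε : ℝ) (hε : 0 < ε) :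
    ∃ δ : ℝ, 0 < δ ∧
    ∀ (X : Fin (d + 1) → Type) [∀ i, Fintype (X i)]
      (μ : (i : Fin (d + 1)) → X i → ℝ),
      (∀ i x, 0 ≤ μ i x) → (∀ i, ∑ x, μ i x = 1) →
    ∀ f : (i : Fin (d + 1)) → ((j : {j : Fin (d + 1) // j ≠ i}) → X j.1) → ℝ,
      (∀ i y, 0 ≤ f i y ∧ f i y ≤ 1) →
      |∑ x : (i : Fin (d + 1)) → X i,
        (∏ i, μ i (x i)) * ∏ i, f i (fun j => x j.1)| ≤ δ →
      ∃ E : (i : Fin (d + 1)) → Set ((j : {j : Fin (d + 1) // j ≠ i}) → X j.1),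
        (∀ x : (i : Fin (d + 1)) → X i,
          ∃ i, (fun j : {j : Fin (d + 1) // j ≠ i} => x j.1) ∉ E i) ∧
        ∀ i, ∑ y : (j : {j : Fin (d + 1) // j ≠ i}) → X j.1,
          (∏ j, μ j.1 (y j)) * (E i)ᶜ.indicator (f i) y ≤ ε := by
  obtain ⟨δ, hδ, hrem⟩ := exists_removal_sets (Fin (d + 1)) (half_pos hε)
  refine ⟨δ * (ε / 2) ^ (d + 1), by positivity, ?_⟩
  intro X _ μ hμ hμ1 f hf hsum
  have hμx : ∀ x : ∀ i, X i, 0 ≤ ∏ i, μ i (x i) := fun x => Finset.prod_nonneg fun i _ => hμ i _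
  obtain ⟨B, hB, hBε⟩ := hrem X μ hμ hμ1 (fun i => {y | ε / 2 ≤ f i y}) (by
    refine le_of_mul_le_mul_right (le_trans ?_ ((le_abs_self _).trans hsum))
      (by positivity : 0 < (ε / 2) ^ (d + 1))
    rw [Finset.sum_mul]
    refine Finset.sum_le_sum fun x _ => ?_
    rw [mul_assoc]
    refine mul_le_mul_of_nonneg_left ?_ (hμx x)
    by_cases hx : x ∈ ⋂ i, {x : ∀ i, X i |
        (fun j : {j // j ≠ i} => x j.1) ∈ {y | ε / 2 ≤ f i y}}
    · rw [indicator_of_mem hx, Pi.one_apply, one_mul]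
      calc (ε / 2) ^ (d + 1) = ∏ _i : Fin (d + 1), ε / 2 := by
            rw [Finset.prod_const, Finset.card_univ, Fintype.card_fin]
        _ ≤ _ := Finset.prod_le_prod (fun _ _ => by positivity) fun i _ => mem_iInter.1 hx i
    · rw [indicator_of_notMem hx, zero_mul]
      exact Finset.prod_nonneg fun i _ => (hf i _).1)
  refine ⟨fun i => (B i)ᶜ, fun x => (hB x).imp fun i hi => not_not_intro hi, fun i => ?_⟩
  simp only [compl_compl]
  rw [← sum_restrict_ne i (hμ1 i)]
  calc _ ≤ ∑ x : ∀ i, X i, ((∏ i, μ i (x i)) * (ε / 2) + (∏ i, μ i (x i)) *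
        {x : ∀ i, X i | (fun j : {j // j ≠ i} => x j.1) ∈ {y | ε / 2 ≤ f i y} ∩ B i}.indicator
          1 x) := by
        refine Finset.sum_le_sum fun x _ => ?_
        rw [← mul_add]
        refine mul_le_mul_of_nonneg_left ?_ (hμx x)
        have h1 := (hf i fun j => x j.1).2
        by_cases hx : (fun j : {j // j ≠ i} => x j.1) ∈ B i
        · rw [indicator_of_mem hx]
          rcases le_total (ε / 2) (f i fun j => x j.1) with h | h
          · rw [indicator_of_mem (s := {x : ∀ i, X i |
              (fun j : {j // j ≠ i} => x j.1) ∈ {y | ε / 2 ≤ f i y} ∩ B i}) (a := x) ⟨h, hx⟩,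
              Pi.one_apply]
            linarith
          · exact h.trans (le_add_of_nonneg_right (indicator_one_nonneg _ _))
        · rw [indicator_of_notMem hx]
          have := indicator_one_nonneg {x : ∀ i, X i |
            (fun j : {j // j ≠ i} => x j.1) ∈ {y | ε / 2 ≤ f i y} ∩ B i} x
          linarith
    _ ≤ ε / 2 + ε / 2 := by
        rw [Finset.sum_add_distrib, ← Finset.sum_mul, sum_prod_weight hμ1, one_mul]
        exact add_le_add_right (hBε i) _
    _ = ε := add_halves ε
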